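/- arXiv:2412.11505 — 5 statements merged into one kernel-verified Lean document; each statement's English description precedes it below -/
import Mathlib

section
/- Let a ≥ 1 be a real number and (q_k)_{k≥0} a bounded sequence in H such that q_{k+1} + (k/a)(q_{k+1} − q_k) converges in norm to some p ∈ H as k → +∞. Then q_k converges in norm to p. -/
open scoped RealInnerProductSpace Pointwise
open Filter

theorem stmt_15
    {H : Type*} [NormedAddCommGroup H] [InnerProductSpace ℝ H] [CompleteSpace H]
    (a : ℝ) (ha : 1 ≤ a) (q : ℕ → H)
    (hbdd : ∃ C : ℝ, ∀ k : ℕ, ‖q k‖ ≤ C)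
    (p : H)
    (hconv : Tendsto (fun k : ℕ => q (k + 1) + ((k : ℝ) / a) • (q (k + 1) - q k)) atTop (nhds p)) :
    Tendsto q atTop (nhds p) := by
  have ha0 : 0 < a := by linarith
  set e : ℕ → ℝ := fun k => ‖q (k + 1) + ((k : ℝ) / a) • (q (k + 1) - q k) - p‖ with he
  have he0 : Tendsto e atTop (nhds 0) := tendsto_iff_norm_sub_tendsto_zero.1 hconv
  have hstep (k : ℕ) : ((k : ℝ) + 1) * ‖q (k + 1) - p‖ ≤ k * ‖q k - p‖ + a * e k := by
    have hid : ((k : ℝ) + a) • (q (k + 1) - p) = (k : ℝ) • (q k - p) +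
        a • (q (k + 1) + ((k : ℝ) / a) • (q (k + 1) - q k) - p) := by
      have h : a * ((k : ℝ) / a) = k := by field_simp
      rw [smul_sub a, smul_add a, smul_smul, h]
      module
    have hn := norm_add_le ((k : ℝ) • (q k - p))
      (a • (q (k + 1) + ((k : ℝ) / a) • (q (k + 1) - q k) - p))
    rw [← hid, norm_smul, norm_smul, norm_smul, Real.norm_of_nonneg (by positivity),
      Real.norm_of_nonneg (by positivity), Real.norm_of_nonneg ha0.le] at hn
    refine le_trans ?_ hn
    gcongr
  have hsum (n : ℕ) : (n : ℝ) * ‖q n - p‖ ≤ a * ∑ i ∈ Finset.range n, e i := by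
    induction n with
    | zero => simp
    | succ n ih =>
      rw [Finset.sum_range_succ]
      push_cast
      linarith [hstep n]
  rw [tendsto_iff_norm_sub_tendsto_zero]
  have hces := he0.cesaro.const_mul a
  rw [mul_zero] at hces
  refine squeeze_zero' (Eventually.of_forall fun _ => norm_nonneg _) ?_ hces
  filter_upwards [eventually_gt_atTop 0] with n hn
  have hn0 : (0 : ℝ) < n := by exact_mod_cast hn
  rw [mul_left_comm, inv_mul_eq_div, le_div_iff₀ hn0, mul_comm]
  exact hsum n
end

section
/- Suppose Zer(M+F) is nonempty. Then for every z* ∈ Zer(M+F), the real sequence (‖z_k − z*‖)_{k≥0} converges, i.e., lim_{k→+∞} ‖z_k − z*‖ exists in ℝ. -/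
open scoped RealInnerProductSpace Pointwise
open Filter

/-- The discrete Lyapunov functional of the scheme. At step `K` it is evaluated at the position
`x = z_K - z*`, the scaled velocity `p = K (z_K - z_{K-1})`, the operator value `y = γ v_K`,
the evaluation error `e = γ (F w_{K-1} - F z_K)` and the increment `D = γ (v_K - v_{K-1})`. -/
noncomputable def energy {H : Type*} [NormedAddCommGroup H] [InnerProductSpace ℝ H]
    (α s l K : ℝ) (x p y e D : H) : ℝ :=
  1 / 2 * ‖l • x + p + (s * K) • y‖ ^ 2 + 1 / 2 * l * (α - 1 - l) * ‖x‖ ^ 2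
    + l * (1 - s) * K * ⟪x, y⟫ + 1 / 2 * s * (1 - s) * K ^ 2 * ‖y‖ ^ 2
    + (1 - s) * K * ⟪p, e⟫ + 1 / 4 * (1 - s) * K ^ 2 * ‖D‖ ^ 2

section Energy

variable {H : Type*} [NormedAddCommGroup H] [InnerProductSpace ℝ H]

theorem le_energy {α s l K : ℝ} (hs0 : 0 ≤ s) (hs1 : s ≤ 1) (hl : 0 ≤ l) (hK : 0 ≤ K)
    {x p y e D : H} (hxy : 0 ≤ ⟪x, y - e⟫) (he : ‖e‖ ≤ 1 / 2 * ‖D‖) :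
    1 / 2 * l * (α - 1 - l) * ‖x‖ ^ 2 ≤ energy α s l K x p y e D := by
  have key : energy α s l K x p y e D = 1 / 2 * l * (α - 1 - l) * ‖x‖ ^ 2
      + 1 / 2 * ‖l • x + p + (s * K) • y + ((1 - s) * K) • e‖ ^ 2
      + 1 / 2 * (s * (1 - s)) * K ^ 2 * ‖y - e‖ ^ 2
      + l * (1 - s) * K * ⟪x, y - e⟫
      + (1 - s) * K ^ 2 * (1 / 4 * ‖D‖ ^ 2 - 1 / 2 * ‖e‖ ^ 2) := by
    simp only [energy, ← real_inner_self_eq_norm_sq, inner_add_left, inner_add_right,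
      inner_sub_left, inner_sub_right, real_inner_smul_left, real_inner_smul_right,
      real_inner_comm x p, real_inner_comm x y, real_inner_comm x e, real_inner_comm p y,
      real_inner_comm p e, real_inner_comm y e]
    ring
  have hs : 0 ≤ 1 - s := by linarith
  have h1 : 0 ≤ 1 / 4 * ‖D‖ ^ 2 - 1 / 2 * ‖e‖ ^ 2 := by
    nlinarith [norm_nonneg e, norm_nonneg D]
  have h2 : 0 ≤ 1 / 2 * (s * (1 - s)) * K ^ 2 * ‖y - e‖ ^ 2 := by positivity
  have h3 : 0 ≤ l * (1 - s) * K * ⟪x, y - e⟫ := by positivity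
  have h4 : 0 ≤ (1 - s) * K ^ 2 * (1 / 4 * ‖D‖ ^ 2 - 1 / 2 * ‖e‖ ^ 2) := by positivity
  rw [key]
  linarith [sq_nonneg ‖l • x + p + (s * K) • y + ((1 - s) * K) • e‖]

theorem energy_sub_energy (α c s l k : ℝ) {x d p₀ y D D₀ e e₀ : H}
    (hp : p₀ = (k + α) • (d + D) + c • (y - D)) :
    energy α s l (k + 1) x ((k + 1) • d) y e D - energy α s l k (x - d) p₀ (y - D) e₀ D₀ =
      -(k * ((α - 1 - l) * ‖d‖ ^ 2 - (l - c - s * (α - 2)) * ⟪d, y⟫ + s * (c - 1) * ‖y‖ ^ 2))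
      - l * (c - 1) * ⟪x, y - e⟫
      - (1 - s) * k ^ 2 * ⟪d, D - e + e₀⟫
      - (1 - s) * k ^ 2 * (1 / 4 * (‖D‖ ^ 2 + ‖D₀‖ ^ 2) + ⟪D, e₀⟫)
      + ((1 / 2 + 1 / 2 * α * l - 1 / 2 * α ^ 2 + 1 / 2 * l) * ⟪d, d⟫
        + (s + c * l - α * c) * ⟪d, y⟫ + (1 / 2 * s - 1 / 2 * c ^ 2) * ⟪y, y⟫
        - l * (c - 1) * ⟪x, e⟫ + (c * l - α * l) * ⟪x, D⟫
        + (1 - s) * ⟪d, e⟫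
        + (1 / 4 - 1 / 4 * s - 1 / 2 * α ^ 2 + α * c - 1 / 2 * c ^ 2) * ⟪D, D⟫
        + (α * l - c * l - α ^ 2 + α * c) * ⟪d, D⟫ + (c ^ 2 - α * c) * ⟪y, D⟫)
      + k * ((2 - 2 * s) * ⟪d, e⟫
        + (1 / 2 - 1 / 2 * s - α + c + α * s - c * s) * ⟪D, D⟫
        + (c + α * s - 2 * α) * ⟪d, D⟫ + (2 * c * s - c - α * s) * ⟪y, D⟫
        + (α * s - α) * ⟪d, e₀⟫ + (c + α * s - α - c * s) * ⟪D, e₀⟫ + (c * s - c) * ⟪y, e₀⟫) := by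
  subst hp
  simp only [energy, ← real_inner_self_eq_norm_sq, inner_add_left, inner_add_right,
    inner_sub_left, inner_sub_right, real_inner_smul_left, real_inner_smul_right,
    real_inner_comm x d, real_inner_comm x y, real_inner_comm x D,
    real_inner_comm d y, real_inner_comm d D, real_inner_comm y D]
  ring

theorem energy_sub_energy_of_slope (α s l l' K : ℝ) (x d y e D : H) :
    energy α s l' K x (K • d) y e D - energy α s l K x (K • d) y e D =
      (l' - l) * (1 / 2 * (α - 1) * ‖x‖ ^ 2 + K * ⟪x, d⟫ + K * ⟪x, y⟫) := by
  simp only [energy, ← real_inner_self_eq_norm_sq, inner_add_left, inner_add_right,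
    real_inner_smul_left, real_inner_smul_right,
    real_inner_comm x d, real_inner_comm x y, real_inner_comm d y]
  ring

end Energy

theorem exists_mul_sq_add_sq_le {β θ ρ : ℝ} (hβ : 0 < β) (hρ : 0 < ρ) (h : θ ^ 2 < 4 * ρ * β) :
    ∃ ε > 0, ∀ a b t : ℝ, |t| ≤ a * b →
      ε * (a ^ 2 + b ^ 2) ≤ β * a ^ 2 - θ * t + ρ * b ^ 2 := by
  set ε := (4 * ρ * β - θ ^ 2) / (4 * (ρ + β)) with hε
  have hε0 : 0 < ε := div_pos (by linarith) (by linarith)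
  have hmul : 4 * ε * (ρ + β) = 4 * ρ * β - θ ^ 2 := by rw [hε]; field_simp
  have hεβ : 0 < β - ε := by nlinarith [sq_nonneg θ, sq_pos_of_pos hβ]
  refine ⟨ε, hε0, fun a b t ht => ?_⟩
  have h1 : θ * t ≤ |θ| * (a * b) :=
    (le_abs_self _).trans (by rw [abs_mul]; exact mul_le_mul_of_nonneg_left ht (abs_nonneg θ))
  have h2 : 0 ≤ (β - ε) * ((β - ε) * a ^ 2 - |θ| * (a * b) + (ρ - ε) * b ^ 2) := by
    have : (β - ε) * ((β - ε) * a ^ 2 - |θ| * (a * b) + (ρ - ε) * b ^ 2)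
        = ((β - ε) * a - |θ| / 2 * b) ^ 2 + ε ^ 2 * b ^ 2 := by
      linear_combination (-b ^ 2 / 4) * sq_abs θ - (b ^ 2 / 4) * hmul
    rw [this]; positivity
  have h3 := nonneg_of_mul_nonneg_right h2 hεβ
  linarith

theorem exists_error_absorption {C ε δ : ℝ} (hC : 0 < C) (hε : 0 < ε) (hδ : 0 < δ) :
    ∃ K₀ ≥ 1, ∃ T ≥ 0, ∀ k ≥ K₀, ∀ X d y D D₀ : ℝ,
      C * ((d + y) ^ 2 + k * ((d + y + D) * (D + D₀)) + X * D) ≤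
        ε / 2 * (k * (d ^ 2 + y ^ 2)) + δ / 2 * (k ^ 2 * (D ^ 2 + D₀ ^ 2)) + T / k ^ 2 * X ^ 2 := by
  refine ⟨1 + 8 * C / ε + 16 * C ^ 2 / (ε * δ) + 16 * C / δ, ?_, 2 * C ^ 2 / δ, by positivity,
    fun k hk X d y D D₀ => ?_⟩
  · have : 0 ≤ 8 * C / ε + 16 * C ^ 2 / (ε * δ) + 16 * C / δ := by positivity
    linarith
  have p1 : 0 ≤ 8 * C / ε := by positivity
  have p2 : 0 ≤ 16 * C ^ 2 / (ε * δ) := by positivity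
  have p3 : 0 ≤ 16 * C / δ := by positivity
  have hk0 : 0 < k := by linarith
  have k1 : 8 * C ≤ k * ε := (div_le_iff₀ hε).1 (by linarith)
  have k2 : 16 * C ^ 2 ≤ k * (ε * δ) := (div_le_iff₀ (by positivity)).1 (by linarith)
  have k3 : 16 * C ≤ k * δ := (div_le_iff₀ hδ).1 (by linarith)
  have e1 : C * (d + y) ^ 2 ≤ ε / 4 * (k * (d ^ 2 + y ^ 2)) := by
    nlinarith [mul_nonneg hC.le (sq_nonneg (d - y)),
      mul_le_mul_of_nonneg_right k1 (add_nonneg (sq_nonneg d) (sq_nonneg y))]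
  have e2 : C * (k * ((d + y) * (D + D₀))) ≤
      ε / 4 * (k * (d ^ 2 + y ^ 2)) + δ / 4 * (k ^ 2 * (D ^ 2 + D₀ ^ 2)) := by
    have a1 : C * ((d + y) * (D + D₀)) ≤ ε / 8 * (d + y) ^ 2 + 2 * C ^ 2 / ε * (D + D₀) ^ 2 := by
      have : ε / 8 * (d + y) ^ 2 + 2 * C ^ 2 / ε * (D + D₀) ^ 2 - C * ((d + y) * (D + D₀))
          = (ε * (d + y) - 4 * C * (D + D₀)) ^ 2 / (8 * ε) := by field_simp; ring
      have h0 : 0 ≤ (ε * (d + y) - 4 * C * (D + D₀)) ^ 2 / (8 * ε) := by positivity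
      linarith
    have a2 : 2 * C ^ 2 / ε ≤ k * δ / 8 := by
      rw [div_le_iff₀ hε]; nlinarith
    have a3 : ε / 8 * (d + y) ^ 2 ≤ ε / 4 * (d ^ 2 + y ^ 2) := by
      nlinarith [mul_nonneg hε.le (sq_nonneg (d - y))]
    have a4 : 2 * C ^ 2 / ε * (D + D₀) ^ 2 ≤ δ / 4 * (k * (D ^ 2 + D₀ ^ 2)) := by
      nlinarith [mul_le_mul_of_nonneg_right a2 (sq_nonneg (D + D₀)),
        mul_nonneg (mul_pos hk0 hδ).le (sq_nonneg (D - D₀))]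
    nlinarith [mul_le_mul_of_nonneg_left (a1.trans (add_le_add a3 a4)) hk0.le]
  have e3 : C * (k * (D * (D + D₀))) ≤ δ / 8 * (k ^ 2 * (D ^ 2 + D₀ ^ 2)) := by
    have a1 : D * (D + D₀) ≤ 2 * (D ^ 2 + D₀ ^ 2) := by
      nlinarith [sq_nonneg (D - D₀), sq_nonneg D, sq_nonneg D₀]
    nlinarith [mul_le_mul_of_nonneg_left a1 (mul_pos hC hk0).le,
      mul_le_mul_of_nonneg_right k3 (mul_nonneg hk0.le (add_nonneg (sq_nonneg D) (sq_nonneg D₀)))]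
  have e4 : C * (X * D) ≤ δ / 8 * (k ^ 2 * D ^ 2) + 2 * C ^ 2 / δ / k ^ 2 * X ^ 2 := by
    have : δ / 8 * (k ^ 2 * D ^ 2) + 2 * C ^ 2 / δ / k ^ 2 * X ^ 2 - C * (X * D)
        = (δ * k ^ 2 * D - 4 * C * X) ^ 2 / (8 * δ * k ^ 2) := by field_simp; ring
    have h0 : 0 ≤ (δ * k ^ 2 * D - 4 * C * X) ^ 2 / (8 * δ * k ^ 2) := by positivity
    linarith
  have e5 : 0 ≤ δ * (k ^ 2 * D₀ ^ 2) := by positivity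
  nlinarith

theorem mul_inner_le_abs_mul {H : Type*} [NormedAddCommGroup H] [InnerProductSpace ℝ H]
    {a b : H} {q : ℝ} (r : ℝ) (h : ‖a‖ * ‖b‖ ≤ q) : r * ⟪a, b⟫ ≤ |r| * q :=
  (le_abs_self _).trans <| by
    rw [abs_mul]
    exact mul_le_mul_of_nonneg_left ((abs_real_inner_le_norm a b).trans h) (abs_nonneg r)

theorem exists_energy_remainder_le (H : Type*) [NormedAddCommGroup H] [InnerProductSpace ℝ H]
    (α c s l : ℝ) :
    ∃ C > 0, ∀ k : ℝ, 1 ≤ k → ∀ x d p₀ y D D₀ e e₀ : H,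
      p₀ = (k + α) • (d + D) + c • (y - D) → ‖e‖ ≤ ‖D‖ → ‖e₀‖ ≤ ‖D₀‖ →
      energy α s l (k + 1) x ((k + 1) • d) y e D - energy α s l k (x - d) p₀ (y - D) e₀ D₀ ≤
        -(k * ((α - 1 - l) * ‖d‖ ^ 2 - (l - c - s * (α - 2)) * ⟪d, y⟫ + s * (c - 1) * ‖y‖ ^ 2))
        - l * (c - 1) * ⟪x, y - e⟫
        - (1 - s) * k ^ 2 * ⟪d, D - e + e₀⟫
        - (1 - s) * k ^ 2 * (1 / 4 * (‖D‖ ^ 2 + ‖D₀‖ ^ 2) + ⟪D, e₀⟫)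
        + C * ((‖d‖ + ‖y‖) ^ 2 + k * ((‖d‖ + ‖y‖ + ‖D‖) * (‖D‖ + ‖D₀‖)) + ‖x‖ * ‖D‖) := by
  refine ⟨(|1 / 2 + 1 / 2 * α * l - 1 / 2 * α ^ 2 + 1 / 2 * l| + |s + c * l - α * c|
    + |1 / 2 * s - 1 / 2 * c ^ 2| + |-(l * (c - 1))| + |c * l - α * l| + |1 - s|
    + |1 / 4 - 1 / 4 * s - 1 / 2 * α ^ 2 + α * c - 1 / 2 * c ^ 2|
    + |α * l - c * l - α ^ 2 + α * c| + |c ^ 2 - α * c|)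
    + (|2 - 2 * s| + |1 / 2 - 1 / 2 * s - α + c + α * s - c * s| + |c + α * s - 2 * α|
    + |2 * c * s - c - α * s| + |α * s - α| + |c + α * s - α - c * s| + |c * s - c|) + 1,
    by positivity,
    fun k hk1 x d p₀ y D D₀ e e₀ hp he' he₀' => ?_⟩
  rw [energy_sub_energy α c s l k hp]
  have hk0 : 0 ≤ k := by linarith
  have hX := norm_nonneg x
  have hd := norm_nonneg d
  have hy := norm_nonneg y
  have hD := norm_nonneg D
  have hD₀ := norm_nonneg D₀
  obtain ⟨Q₁, hQ₁⟩ : ∃ q, (‖d‖ + ‖y‖ + ‖D‖) * (‖D‖ + ‖D₀‖) = q := ⟨_, rfl⟩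
  obtain ⟨Q, hQ⟩ : ∃ q, (‖d‖ + ‖y‖) ^ 2 + k * Q₁ + ‖x‖ * ‖D‖ = q := ⟨_, rfl⟩
  have hQ₁0 : 0 ≤ Q₁ := by rw [← hQ₁]; positivity
  have hkQ₁ : Q₁ ≤ k * Q₁ := le_mul_of_one_le_left hQ₁0 hk1
  have hsq : 0 ≤ (‖d‖ + ‖y‖) ^ 2 := sq_nonneg _
  have hXD : 0 ≤ ‖x‖ * ‖D‖ := by positivity
  have le₁ {a b : ℝ} (u v : H) (hu : ‖u‖ ≤ a) (hv : ‖v‖ ≤ b) (hab : a * b ≤ Q₁) :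
      ‖u‖ * ‖v‖ ≤ Q₁ :=
    (mul_le_mul hu hv (norm_nonneg v) ((norm_nonneg u).trans hu)).trans hab
  have hQ₁Q : Q₁ ≤ Q := by linarith
  have b_de : ‖d‖ * ‖e‖ ≤ Q₁ := le₁ d e (by linarith) (by linarith) hQ₁.le
  have b_DD : ‖D‖ * ‖D‖ ≤ Q₁ := le₁ D D (by linarith) (by linarith) hQ₁.le
  have b_dD : ‖d‖ * ‖D‖ ≤ Q₁ := le₁ d D (by linarith) (by linarith) hQ₁.le
  have b_yD : ‖y‖ * ‖D‖ ≤ Q₁ := le₁ y D (by linarith) (by linarith) hQ₁.le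
  have b_de₀ : ‖d‖ * ‖e₀‖ ≤ Q₁ := le₁ d e₀ (by linarith) (by linarith) hQ₁.le
  have b_De₀ : ‖D‖ * ‖e₀‖ ≤ Q₁ := le₁ D e₀ (by linarith) (by linarith) hQ₁.le
  have b_ye₀ : ‖y‖ * ‖e₀‖ ≤ Q₁ := le₁ y e₀ (by linarith) (by linarith) hQ₁.le
  have b_dd : ‖d‖ * ‖d‖ ≤ Q := by nlinarith only [hd, hy, hkQ₁, hQ₁0, hXD, hQ]
  have b_dy : ‖d‖ * ‖y‖ ≤ Q := by nlinarith only [hd, hy, hkQ₁, hQ₁0, hXD, hQ]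
  have b_yy : ‖y‖ * ‖y‖ ≤ Q := by nlinarith only [hd, hy, hkQ₁, hQ₁0, hXD, hQ]
  have b_xD : ‖x‖ * ‖D‖ ≤ Q := by linarith [mul_nonneg hk0 hQ₁0]
  have b_xe : ‖x‖ * ‖e‖ ≤ Q := (mul_le_mul_of_nonneg_left he' hX).trans b_xD
  have hconst : (1 / 2 + 1 / 2 * α * l - 1 / 2 * α ^ 2 + 1 / 2 * l) * ⟪d, d⟫
        + (s + c * l - α * c) * ⟪d, y⟫ + (1 / 2 * s - 1 / 2 * c ^ 2) * ⟪y, y⟫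
        - l * (c - 1) * ⟪x, e⟫ + (c * l - α * l) * ⟪x, D⟫
        + (1 - s) * ⟪d, e⟫
        + (1 / 4 - 1 / 4 * s - 1 / 2 * α ^ 2 + α * c - 1 / 2 * c ^ 2) * ⟪D, D⟫
        + (α * l - c * l - α ^ 2 + α * c) * ⟪d, D⟫ + (c ^ 2 - α * c) * ⟪y, D⟫ ≤
      (|1 / 2 + 1 / 2 * α * l - 1 / 2 * α ^ 2 + 1 / 2 * l| + |s + c * l - α * c|
    + |1 / 2 * s - 1 / 2 * c ^ 2| + |-(l * (c - 1))| + |c * l - α * l| + |1 - s|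
    + |1 / 4 - 1 / 4 * s - 1 / 2 * α ^ 2 + α * c - 1 / 2 * c ^ 2|
    + |α * l - c * l - α ^ 2 + α * c| + |c ^ 2 - α * c|) * Q := by
    linarith [mul_inner_le_abs_mul (1 / 2 + 1 / 2 * α * l - 1 / 2 * α ^ 2 + 1 / 2 * l) b_dd,
      mul_inner_le_abs_mul (s + c * l - α * c) b_dy,
      mul_inner_le_abs_mul (1 / 2 * s - 1 / 2 * c ^ 2) b_yy,
      mul_inner_le_abs_mul (-(l * (c - 1))) b_xe, mul_inner_le_abs_mul (c * l - α * l) b_xD,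
      mul_inner_le_abs_mul (1 - s) (b_de.trans hQ₁Q),
      mul_inner_le_abs_mul (1 / 4 - 1 / 4 * s - 1 / 2 * α ^ 2 + α * c - 1 / 2 * c ^ 2)
        (b_DD.trans hQ₁Q),
      mul_inner_le_abs_mul (α * l - c * l - α ^ 2 + α * c) (b_dD.trans hQ₁Q),
      mul_inner_le_abs_mul (c ^ 2 - α * c) (b_yD.trans hQ₁Q)]
  have hlin : (2 - 2 * s) * ⟪d, e⟫
        + (1 / 2 - 1 / 2 * s - α + c + α * s - c * s) * ⟪D, D⟫
        + (c + α * s - 2 * α) * ⟪d, D⟫ + (2 * c * s - c - α * s) * ⟪y, D⟫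
        + (α * s - α) * ⟪d, e₀⟫ + (c + α * s - α - c * s) * ⟪D, e₀⟫
        + (c * s - c) * ⟪y, e₀⟫ ≤
      (|2 - 2 * s| + |1 / 2 - 1 / 2 * s - α + c + α * s - c * s| + |c + α * s - 2 * α|
    + |2 * c * s - c - α * s| + |α * s - α| + |c + α * s - α - c * s| + |c * s - c|) * Q₁ := by
    linarith [mul_inner_le_abs_mul (2 - 2 * s) b_de,
      mul_inner_le_abs_mul (1 / 2 - 1 / 2 * s - α + c + α * s - c * s) b_DD,
      mul_inner_le_abs_mul (c + α * s - 2 * α) b_dD,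
      mul_inner_le_abs_mul (2 * c * s - c - α * s) b_yD,
      mul_inner_le_abs_mul (α * s - α) b_de₀,
      mul_inner_le_abs_mul (c + α * s - α - c * s) b_De₀,
      mul_inner_le_abs_mul (c * s - c) b_ye₀]
  have hQ0 : 0 ≤ Q := hQ₁0.trans hQ₁Q
  have hlin' := mul_le_mul_of_nonneg_left hlin hk0
  rw [mul_left_comm] at hlin'
  have hC₂Q := hlin'.trans
    (mul_le_mul_of_nonneg_left (by linarith : k * Q₁ ≤ Q) (by positivity))
  rw [hQ₁, hQ]
  linarith only [hconst, hC₂Q, hQ0]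

theorem exists_energy_descent (H : Type*) [NormedAddCommGroup H] [InnerProductSpace ℝ H]
    {α c s l κ : ℝ} (hs0 : 0 < s) (hs1 : s < 1) (hlα : l < α - 1) (hc : 1 < c)
    (hκ0 : 0 ≤ κ) (hκ : κ < 1 / 2)
    (hθ : (l - c - s * (α - 2)) ^ 2 < 4 * (s * (c - 1)) * (α - 1 - l)) :
    ∃ μ > 0, ∃ T ≥ 0, ∃ K₀ : ℝ, ∀ k ≥ K₀, ∀ x d p₀ y D D₀ e e₀ : H,
      p₀ = (k + α) • (d + D) + c • (y - D) → ‖e‖ ≤ κ * ‖D‖ → ‖e₀‖ ≤ κ * ‖D₀‖ →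
      0 ≤ ⟪d, D - e + e₀⟫ →
      energy α s l (k + 1) x ((k + 1) • d) y e D + l * (c - 1) * ⟪x, y - e⟫
          + μ * (k * ‖d‖ ^ 2 + k ^ 2 * ‖D‖ ^ 2)
        ≤ energy α s l k (x - d) p₀ (y - D) e₀ D₀ + T / k ^ 2 * ‖x‖ ^ 2 := by
  obtain ⟨ε, hε, hform⟩ :=
    exists_mul_sq_add_sq_le (by linarith) (mul_pos hs0 (by linarith : 0 < c - 1)) hθ
  set δ := (1 - s) * (1 / 4 - κ / 2) with hδ
  have hδ0 : 0 < δ := mul_pos (by linarith) (by linarith)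
  obtain ⟨C, hC, hrem⟩ := exists_energy_remainder_le H α c s l
  obtain ⟨K₀, hK₀, T, hT, habs⟩ := exists_error_absorption hC hε hδ0
  refine ⟨min (ε / 2) (δ / 2), by positivity, T, hT, K₀,
    fun k hk x d p₀ y D D₀ e e₀ hp he he₀ hmono => ?_⟩
  have hk1 : 1 ≤ k := hK₀.le.trans hk
  have hk0 : 0 ≤ k := by linarith
  have hquad := hform ‖d‖ ‖y‖ ⟪d, y⟫ (abs_real_inner_le_norm d y)
  have herr := habs k hk ‖x‖ ‖d‖ ‖y‖ ‖D‖ ‖D₀‖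
  have hD := norm_nonneg D
  have hD₀ := norm_nonneg D₀
  have he' : ‖e‖ ≤ ‖D‖ := he.trans (mul_le_of_le_one_left hD (by linarith))
  have he₀' : ‖e₀‖ ≤ ‖D₀‖ := he₀.trans (mul_le_of_le_one_left hD₀ (by linarith))
  have hdiff := hrem k hk1 x d p₀ y D D₀ e e₀ hp he' he₀'
  have hcross : δ * (‖D‖ ^ 2 + ‖D₀‖ ^ 2) ≤
      (1 - s) * (1 / 4 * (‖D‖ ^ 2 + ‖D₀‖ ^ 2) + ⟪D, e₀⟫) := by
    rw [hδ, mul_assoc]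
    refine mul_le_mul_of_nonneg_left ?_ (by linarith)
    have h1 := neg_le_of_abs_le (abs_real_inner_le_norm D e₀)
    have h2 := mul_le_mul_of_nonneg_left he₀ hD
    nlinarith only [h1, h2, mul_nonneg hκ0 (sq_nonneg (‖D‖ - ‖D₀‖))]
  have hcross' := mul_le_mul_of_nonneg_left hcross (sq_nonneg k)
  have hquad' := mul_le_mul_of_nonneg_left hquad hk0
  have hmono' : 0 ≤ (1 - s) * k ^ 2 * ⟪d, D - e + e₀⟫ :=
    mul_nonneg (mul_nonneg (by linarith) (sq_nonneg k)) hmono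
  have hμ₁ := mul_le_mul_of_nonneg_right (min_le_left (ε / 2) (δ / 2))
    (mul_nonneg hk0 (sq_nonneg ‖d‖))
  have hμ₂ := mul_le_mul_of_nonneg_right (min_le_right (ε / 2) (δ / 2))
    (mul_nonneg (sq_nonneg k) (sq_nonneg ‖D‖))
  have r₁ : 0 ≤ ε * (k * ‖y‖ ^ 2) := by positivity
  have r₂ : 0 ≤ δ * (k ^ 2 * ‖D₀‖ ^ 2) := by positivity
  linarith only [hdiff, hquad', hmono', hcross', herr, hμ₁, hμ₂, r₁, r₂]

theorem tendsto_and_summable_of_almost_decreasing {E b : ℕ → ℝ} {T : ℝ} (hT : 0 ≤ T)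
    (hE : ∀ᶠ k in atTop, 0 ≤ E k) (hb : ∀ᶠ k in atTop, 0 ≤ b k)
    (h : ∀ᶠ k : ℕ in atTop, E (k + 1) + b k ≤ E k + T / ((k : ℝ) + 1) ^ 2 * E (k + 1)) :
    (∃ l, Tendsto E atTop (nhds l)) ∧ Summable b := by
  set μ : ℕ → ℝ := fun k => 1 + 4 * T / ((k : ℝ) + 1) with hμ
  have hμ1 : Tendsto μ atTop (nhds 1) := by
    have := (tendsto_one_div_add_atTop_nhds_zero_nat (𝕜 := ℝ)).const_mul (4 * T)
    simpa [hμ, div_eq_mul_inv] using this.const_add 1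
  have hμpos : ∀ k, 1 ≤ μ k := fun k => by
    have : 0 ≤ 4 * T / ((k : ℝ) + 1) := by positivity
    simp only [hμ]; linarith
  obtain ⟨N, hN⟩ := eventually_atTop.1
    (hE.and (hb.and (h.and (tendsto_natCast_atTop_atTop.eventually_ge_atTop (4 * T)))))
  have hstep : ∀ k ≥ N, μ (k + 1) * E (k + 1) + b k ≤ μ k * E k := by
    intro k hk
    obtain ⟨-, hbk, hk', hkT⟩ := hN k hk
    have hEk := (hN (k + 1) (by omega)).1
    have hm : μ (k + 1) ≤ μ k * (1 - T / ((k : ℝ) + 1) ^ 2) := by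
      have hk0 : (0 : ℝ) ≤ k := k.cast_nonneg
      have : μ k * (1 - T / ((k : ℝ) + 1) ^ 2) - μ (k + 1) =
          T * ((4 * (k + 1) - (k + 2)) * (k + 1) - 4 * T * (k + 2)) / ((k + 1) ^ 3 * (k + 2)) := by
        simp only [hμ]; push_cast; field_simp; ring
      have h0 : 0 ≤ T * ((4 * ((k : ℝ) + 1) - (k + 2)) * (k + 1) - 4 * T * (k + 2)) /
          ((k + 1) ^ 3 * (k + 2)) := by
        refine div_nonneg (mul_nonneg hT ?_) (by positivity)
        nlinarith [mul_le_mul_of_nonneg_right hkT (by positivity : (0 : ℝ) ≤ (k : ℝ) + 2)]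
      linarith
    have h1 := mul_le_mul_of_nonneg_right hm hEk
    have h2 := mul_le_mul_of_nonneg_left hk' (zero_le_one.trans (hμpos k))
    have h3 := mul_le_mul_of_nonneg_right (hμpos k) hbk
    linarith
  have hG0 : ∀ n, 0 ≤ μ (n + N) * E (n + N) := fun n =>
    mul_nonneg (zero_le_one.trans (hμpos _)) (hN _ (by omega)).1
  constructor
  · have hanti : Antitone fun n => μ (n + N) * E (n + N) := antitone_nat_of_succ_le fun n => by
      have h1 := hstep (n + N) (by omega)
      have h2 := (hN (n + N) (by omega)).2.1
      rw [show n + 1 + N = n + N + 1 by omega]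
      linarith
    have hlim := tendsto_atTop_ciInf hanti ⟨0, by rintro _ ⟨n, rfl⟩; exact hG0 n⟩
    have hlim' := (tendsto_add_atTop_iff_nat (f := fun n => μ n * E n) N).1 hlim
    refine ⟨_, (hlim'.div hμ1 one_ne_zero).congr fun n => ?_⟩
    have := (zero_lt_one.trans_le (hμpos n)).ne'
    simp only [Pi.div_apply]
    field_simp
  · refine (summable_nat_add_iff N).1 (summable_of_sum_range_le (c := μ N * E N)
      (fun n => (hN _ (by omega)).2.1) fun n => ?_)
    have hsum : ∑ i ∈ Finset.range n, b (i + N) + μ (n + N) * E (n + N) ≤ μ N * E N := by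
      induction n with
      | zero => simp
      | succ n ih =>
        have h1 := hstep (n + N) (by omega)
        rw [Finset.sum_range_succ, show n + 1 + N = n + N + 1 by omega]
        linarith
    linarith [hG0 n]

theorem tendsto_zero_of_mul_succ_le {β : ℝ} (hβ : 0 < β) {y : ℕ → ℝ} (hy : ∀ k, 0 ≤ y k)
    (h : ∀ᶠ k : ℕ in atTop, (β + ((k : ℝ) + 1)) * y (k + 1) ≤ ((k : ℝ) + 1) * y k) :
    Tendsto y atTop (nhds 0) := by
  obtain ⟨⟨l, hl⟩, hsum⟩ := tendsto_and_summable_of_almost_decreasing (E := y)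
    (b := fun k => β * y (k + 1) / ((k : ℝ) + 1)) le_rfl (.of_forall hy)
    (.of_forall fun k => by have := hy (k + 1); positivity)
    (h.mono fun k hk => by
      have hk0 : (0 : ℝ) < (k : ℝ) + 1 := by positivity
      have : y (k + 1) + β * y (k + 1) / ((k : ℝ) + 1)
          = (β + ((k : ℝ) + 1)) * y (k + 1) / ((k : ℝ) + 1) := by field_simp; ring
      rw [this, zero_div, zero_mul, add_zero, div_le_iff₀ hk0]
      linarith)
  have hl0 : 0 ≤ l := ge_of_tendsto' hl hy
  rcases hl0.eq_or_lt with rfl | hlpos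
  · exact hl
  exfalso
  have hlow : ∀ᶠ k : ℕ in atTop, l / 2 < y (k + 1) :=
    ((tendsto_add_atTop_iff_nat 1).2 hl).eventually (lt_mem_nhds (by linarith))
  refine Real.not_summable_one_div_natCast ((summable_nat_add_iff 1).1 ?_)
  refine Summable.of_norm_bounded_eventually_nat (hsum.mul_left (2 / (β * l)))
    (hlow.mono fun k hk => ?_)
  have hk0 : (0 : ℝ) < (k : ℝ) + 1 := by positivity
  rw [Real.norm_of_nonneg (by positivity)]
  have : 2 / (β * l) * (β * y (k + 1) / ((k : ℝ) + 1)) = (2 * y (k + 1) / l) / ((k : ℝ) + 1) := by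
    field_simp
  rw [this]
  push_cast
  gcongr
  rw [le_div_iff₀ hlpos]
  linarith

theorem tendsto_of_tendsto_mul_add_mul_sub {β r : ℝ} (hβ : 0 < β) {ψ : ℕ → ℝ}
    (h : Tendsto (fun k : ℕ => β * ψ (k + 1) + ((k : ℝ) + 1) * (ψ (k + 1) - ψ k)) atTop (nhds r)) :
    Tendsto ψ atTop (nhds (r / β)) := by
  rw [Metric.tendsto_atTop']
  intro ε hε
  have hr : ∀ᶠ k : ℕ in atTop,
      |β * ψ (k + 1) + ((k : ℝ) + 1) * (ψ (k + 1) - ψ k) - r| < β * (ε / 2) := by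
    simpa [Real.dist_eq] using h.eventually
      (Metric.ball_mem_nhds r (by positivity : 0 < β * (ε / 2)))
  have hy : Tendsto (fun k => max 0 (|ψ k - r / β| - ε / 2)) atTop (nhds 0) := by
    refine tendsto_zero_of_mul_succ_le hβ (fun k => le_max_left _ _) (hr.mono fun k hk => ?_)
    have hk0 : (0 : ℝ) < (k : ℝ) + 1 := by positivity
    have hpos : 0 < β + ((k : ℝ) + 1) := by positivity
    rw [mul_max_of_nonneg _ _ hpos.le, mul_zero]
    refine max_le (mul_nonneg hk0.le (le_max_left _ _)) ?_
    refine le_trans ?_ (mul_le_mul_of_nonneg_left (le_max_right _ _) hk0.le)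
    have hid : (β + ((k : ℝ) + 1)) * (ψ (k + 1) - r / β) = ((k : ℝ) + 1) * (ψ k - r / β)
        + (β * ψ (k + 1) + ((k : ℝ) + 1) * (ψ (k + 1) - ψ k) - r) := by field_simp; ring
    have habs : (β + ((k : ℝ) + 1)) * |ψ (k + 1) - r / β| ≤ ((k : ℝ) + 1) * |ψ k - r / β|
        + |β * ψ (k + 1) + ((k : ℝ) + 1) * (ψ (k + 1) - ψ k) - r| := by
      rw [← abs_of_pos hpos, ← abs_mul, hid]
      refine (abs_add_le _ _).trans ?_
      rw [abs_mul, abs_of_pos hk0]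
    linarith
  obtain ⟨N, hN⟩ := eventually_atTop.1 (hy.eventually (gt_mem_nhds (by positivity : 0 < ε / 2)))
  refine ⟨N, fun n hn => ?_⟩
  have := (le_max_right _ _).trans_lt (hN n hn.le)
  rw [Real.dist_eq]
  linarith

section Scheme

variable {H : Type*} [NormedAddCommGroup H] [InnerProductSpace ℝ H] {x y e : ℕ → H} {α c κ : ℝ}

theorem energy_tendsto_and_summable {s l : ℝ} (hs0 : 0 < s) (hs1 : s < 1) (hl : 0 < l)
    (hlα : l < α - 1) (hc : 1 < c) (hκ0 : 0 ≤ κ) (hκ : κ < 1 / 2)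
    (hθ : (l - c - s * (α - 2)) ^ 2 < 4 * (s * (c - 1)) * (α - 1 - l))
    (hrec : ∀ k : ℕ, ((k : ℝ) + 1) • (x (k + 1) - x k) = ((k : ℝ) + 1 + α) •
      (x (k + 2) - x (k + 1) + (y (k + 2) - y (k + 1))) + c • y (k + 1))
    (he : ∀ k, 1 ≤ k → ‖e (k + 1)‖ ≤ κ * ‖y (k + 1) - y k‖)
    (hmono : ∀ k, 1 ≤ k → 0 ≤ ⟪x (k + 1) - x k, y (k + 1) - y k - e (k + 1) + e k⟫)
    (hpos : ∀ k, 1 ≤ k → 0 ≤ ⟪x k, y k - e k⟫) :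
    (∃ r, Tendsto (fun k : ℕ => energy α s l ((k : ℝ) + 1) (x (k + 1))
      (((k : ℝ) + 1) • (x (k + 1) - x k)) (y (k + 1)) (e (k + 1)) (y (k + 1) - y k))
      atTop (nhds r)) ∧
    (∃ B, ∀ᶠ k in atTop, ‖x k‖ ≤ B) ∧
    Summable (fun k : ℕ => ⟪x (k + 2), y (k + 2) - e (k + 2)⟫) ∧
    Summable (fun k : ℕ => ((k : ℝ) + 1) * ‖x (k + 2) - x (k + 1)‖ ^ 2) ∧
    Summable (fun k : ℕ => ((k : ℝ) + 1) ^ 2 * ‖y (k + 2) - y (k + 1)‖ ^ 2) := by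
  obtain ⟨μ, hμ, T, hT, K₀, hdesc⟩ :=
    exists_energy_descent H hs0 hs1 hlα hc hκ0 hκ hθ
  set E : ℕ → ℝ := fun k => energy α s l ((k : ℝ) + 1) (x (k + 1))
    (((k : ℝ) + 1) • (x (k + 1) - x k)) (y (k + 1)) (e (k + 1)) (y (k + 1) - y k) with hE
  set m := 1 / 2 * l * (α - 1 - l) with hm
  have hm0 : 0 < m := mul_pos (by linarith) (by linarith)
  have hlc : 0 < l * (c - 1) := mul_pos hl (by linarith)
  have hlow : ∀ k, 1 ≤ k → m * ‖x (k + 1)‖ ^ 2 ≤ E k := fun k hk =>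
    le_energy hs0.le hs1.le hl.le (by positivity) (hpos _ (by omega))
      ((he k hk).trans (mul_le_mul_of_nonneg_right hκ.le (norm_nonneg _)))
  have hb : ∀ k : ℕ, 0 ≤ μ * (((k : ℝ) + 1) * ‖x (k + 2) - x (k + 1)‖ ^ 2
      + ((k : ℝ) + 1) ^ 2 * ‖y (k + 2) - y (k + 1)‖ ^ 2) := fun k => by positivity
  have hp : ∀ k : ℕ, 0 ≤ l * (c - 1) * ⟪x (k + 2), y (k + 2) - e (k + 2)⟫ := fun k =>
    mul_nonneg hlc.le (hpos _ (by omega))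
  obtain ⟨hconv, hsum⟩ := tendsto_and_summable_of_almost_decreasing (E := E)
    (b := fun k => l * (c - 1) * ⟪x (k + 2), y (k + 2) - e (k + 2)⟫
      + μ * (((k : ℝ) + 1) * ‖x (k + 2) - x (k + 1)‖ ^ 2
      + ((k : ℝ) + 1) ^ 2 * ‖y (k + 2) - y (k + 1)‖ ^ 2)) (T := T / m) (by positivity)
    (eventually_atTop.2 ⟨1, fun k hk =>
      (by positivity : 0 ≤ m * ‖x (k + 1)‖ ^ 2).trans (hlow k hk)⟩)
    (.of_forall fun k => add_nonneg (hp k) (hb k))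
    (by
      filter_upwards [eventually_ge_atTop 1,
        tendsto_natCast_atTop_atTop.eventually_ge_atTop K₀] with k hk1 hkK
      have hstep := hdesc ((k : ℝ) + 1) (by linarith) (x (k + 2)) (x (k + 2) - x (k + 1))
        (((k : ℝ) + 1) • (x (k + 1) - x k)) (y (k + 2)) (y (k + 2) - y (k + 1))
        (y (k + 1) - y k) (e (k + 2)) (e (k + 1)) (by rw [hrec k, sub_sub_cancel])
        (he (k + 1) (by omega)) (he k hk1) (hmono (k + 1) (by omega))
      rw [sub_sub_cancel, sub_sub_cancel] at hstep
      have hE1 : E (k + 1) = energy α s l ((k : ℝ) + 1 + 1) (x (k + 2))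
          (((k : ℝ) + 1 + 1) • (x (k + 2) - x (k + 1))) (y (k + 2)) (e (k + 2))
          (y (k + 2) - y (k + 1)) := by
        simp only [hE]; push_cast; rfl
      rw [← hE1] at hstep
      have hX : T / ((k : ℝ) + 1) ^ 2 * ‖x (k + 2)‖ ^ 2
          ≤ T / m / ((k : ℝ) + 1) ^ 2 * E (k + 1) := by
        have := mul_le_mul_of_nonneg_left (hlow (k + 1) (by omega))
          (by positivity : 0 ≤ T / m / ((k : ℝ) + 1) ^ 2)
        refine le_of_eq_of_le ?_ this
        field_simp
      linarith)
  refine ⟨hconv, ?_, ?_, ?_, ?_⟩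
  · obtain ⟨r, hr⟩ := hconv
    refine ⟨√((r + 1) / m), (eventually_atTop.2 ?_)⟩
    obtain ⟨N, hN⟩ := eventually_atTop.1
      ((hr.eventually (gt_mem_nhds (lt_add_one r))).and (eventually_ge_atTop 1))
    refine ⟨N + 1, fun k hk => Real.le_sqrt_of_sq_le ?_⟩
    obtain ⟨j, rfl⟩ : ∃ j, k = j + 1 := ⟨k - 1, by omega⟩
    have hj := hN j (by omega)
    rw [le_div_iff₀ hm0, mul_comm]
    exact (hlow j hj.2).trans hj.1.le
  · refine (summable_mul_left_iff hlc.ne').1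
      (hsum.of_nonneg_of_le hp fun k => ?_)
    linarith [hb k]
  · refine (summable_mul_left_iff hμ.ne').1
      (hsum.of_nonneg_of_le (fun k => by positivity) fun k => ?_)
    have : 0 ≤ μ * (((k : ℝ) + 1) ^ 2 * ‖y (k + 2) - y (k + 1)‖ ^ 2) := by positivity
    linarith [hp k]
  · refine (summable_mul_left_iff hμ.ne').1
      (hsum.of_nonneg_of_le (fun k => by positivity) fun k => ?_)
    have : 0 ≤ μ * (((k : ℝ) + 1) * ‖x (k + 2) - x (k + 1)‖ ^ 2) := by positivity
    linarith [hp k]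

theorem summable_inner_of_summable {B : ℝ} (hκ : κ < 1 / 2)
    (he : ∀ k, 1 ≤ k → ‖e (k + 1)‖ ≤ κ * ‖y (k + 1) - y k‖)
    (hB : ∀ᶠ k in atTop, ‖x k‖ ≤ B)
    (hpos : Summable (fun k : ℕ => ⟪x (k + 2), y (k + 2) - e (k + 2)⟫))
    (hD : Summable (fun k : ℕ => ((k : ℝ) + 1) ^ 2 * ‖y (k + 2) - y (k + 1)‖ ^ 2)) :
    Summable (fun k => ⟪x k, y k⟫) := by
  have hinv : Summable (fun k : ℕ => 1 / ((k : ℝ) + 1) ^ 2) := by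
    simpa using (summable_nat_add_iff 1).2 (Real.summable_one_div_nat_pow.2 one_lt_two)
  have hxe : Summable (fun k : ℕ => ⟪x (k + 2), e (k + 2)⟫) := by
    refine Summable.of_norm_bounded_eventually_nat ((hinv.add hD).mul_left B) ?_
    filter_upwards [(tendsto_add_atTop_nat 2).eventually hB] with k hk
    have hB0 : 0 ≤ B := (norm_nonneg _).trans hk
    refine (norm_inner_le_norm _ _).trans (mul_le_mul hk ?_ (norm_nonneg _) hB0)
    have h1 := he (k + 1) (by omega)
    have h2 : κ * ‖y (k + 2) - y (k + 1)‖ ≤ 1 / 2 * ‖y (k + 2) - y (k + 1)‖ :=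
      mul_le_mul_of_nonneg_right hκ.le (norm_nonneg _)
    have h3 := two_mul_le_add_sq (1 / ((k : ℝ) + 1)) (((k : ℝ) + 1) * ‖y (k + 2) - y (k + 1)‖)
    have h4 : 2 * (1 / ((k : ℝ) + 1)) * (((k : ℝ) + 1) * ‖y (k + 2) - y (k + 1)‖)
        = 2 * ‖y (k + 2) - y (k + 1)‖ := by field_simp
    rw [h4, div_pow, one_pow, mul_pow] at h3
    linarith [norm_nonneg (y (k + 2) - y (k + 1))]
  refine (summable_nat_add_iff 2).1 ((hpos.add hxe).congr fun k => ?_)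
  rw [inner_sub_right, sub_add_cancel]

theorem tendsto_norm_of_scheme (hα : c < α - 1) (hc : 1 < c) (hκ0 : 0 ≤ κ) (hκ : κ < 1 / 2)
    (hrec : ∀ k : ℕ, ((k : ℝ) + 1) • (x (k + 1) - x k) = ((k : ℝ) + 1 + α) •
      (x (k + 2) - x (k + 1) + (y (k + 2) - y (k + 1))) + c • y (k + 1))
    (he : ∀ k, 1 ≤ k → ‖e (k + 1)‖ ≤ κ * ‖y (k + 1) - y k‖)
    (hmono : ∀ k, 1 ≤ k → 0 ≤ ⟪x (k + 1) - x k, y (k + 1) - y k - e (k + 1) + e k⟫)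
    (hpos : ∀ k, 1 ≤ k → 0 ≤ ⟪x k, y k - e k⟫) :
    ∃ r, Tendsto (fun k => ‖x k‖) atTop (nhds r) := by
  have hα2 : 0 < α - 2 := by linarith
  obtain ⟨s, hs⟩ : ∃ s, s = (α - 1 - c) / (2 * (α - 2)) := ⟨_, rfl⟩
  have hsα : s * (α - 2) = (α - 1 - c) / 2 := by rw [hs]; field_simp
  have hs0 : 0 < s := by rw [hs]; exact div_pos (by linarith) (by linarith)
  have hs1 : s < 1 := by rw [hs, div_lt_one (by linarith)]; linarith
  have hsc : 0 < s * (c - 1) := mul_pos hs0 (by linarith)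
  obtain ⟨η, hη0, hη₁, hη₂⟩ : ∃ η > 0, η < (α - 1 - c) / 4 ∧ η < s * (c - 1) := by
    obtain ⟨η, h0, h1⟩ := exists_between
      (lt_min (by linarith : 0 < (α - 1 - c) / 4) hsc)
    exact ⟨η, h0, h1.trans_le (min_le_left _ _), h1.trans_le (min_le_right _ _)⟩
  obtain ⟨⟨r₁, hr₁⟩, ⟨B, hB⟩, hsum, hd, hD⟩ := energy_tendsto_and_summable
    (l := (α - 1 + c) / 2) hs0 hs1 (by linarith) (by linarith) hc hκ0 hκ
    (by
      rw [hsα, show (α - 1 + c) / 2 - c - (α - 1 - c) / 2 = 0 by ring]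
      have : 0 < 4 * (s * (c - 1)) * (α - 1 - (α - 1 + c) / 2) :=
        mul_pos (by linarith) (by linarith)
      simpa using this) hrec he hmono hpos
  obtain ⟨⟨r₂, hr₂⟩, -⟩ := energy_tendsto_and_summable
    (l := (α - 1 + c) / 2 + η) hs0 hs1 (by linarith) (by linarith) hc hκ0 hκ
    (by
      rw [hsα, show (α - 1 + c) / 2 + η - c - (α - 1 - c) / 2 = η by ring]
      nlinarith) hrec he hmono hpos
  have ha := summable_inner_of_summable hκ he hB hsum hD
  have hq : Tendsto (fun k : ℕ => 1 / 2 * (α - 1) * ‖x (k + 1)‖ ^ 2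
      + ((k : ℝ) + 1) * ⟪x (k + 1), x (k + 1) - x k⟫ + ((k : ℝ) + 1) * ⟪x (k + 1), y (k + 1)⟫)
      atTop (nhds ((r₂ - r₁) / η)) := by
    refine ((hr₂.sub hr₁).div_const η).congr fun k => ?_
    rw [energy_sub_energy_of_slope, add_sub_cancel_left, mul_div_cancel_left₀ _ hη0.ne']
  have hd0 : Tendsto (fun k : ℕ => ((k : ℝ) + 1) * ‖x (k + 1) - x k‖ ^ 2) atTop (nhds 0) := by
    refine (tendsto_add_atTop_iff_nat 1).1 ?_
    have h2 := hd.tendsto_atTop_zero.const_mul 2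
    rw [mul_zero] at h2
    refine squeeze_zero (fun k => by positivity) (fun k => ?_) h2
    have : (0 : ℝ) ≤ (k : ℝ) * ‖x (k + 2) - x (k + 1)‖ ^ 2 := by positivity
    push_cast
    rw [show k + 1 + 1 = k + 2 from rfl]
    linarith
  have hS : Tendsto (fun k => ∑ i ∈ Finset.range (k + 1), ⟪x i, y i⟫) atTop
      (nhds (∑' i, ⟪x i, y i⟫)) :=
    (tendsto_add_atTop_iff_nat 1).2 ha.hasSum.tendsto_sum_nat
  have hψ := tendsto_of_tendsto_mul_add_mul_sub (β := α - 1) (by linarith)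
    (ψ := fun k => 1 / 2 * ‖x k‖ ^ 2 + ∑ i ∈ Finset.range (k + 1), ⟪x i, y i⟫)
    (((hq.sub (hd0.const_mul (1 / 2))).add
      (((tendsto_add_atTop_iff_nat 1).2 hS).const_mul (α - 1))).congr fun k => by
        rw [Finset.sum_range_succ _ (k + 1), norm_sub_sq_real, inner_sub_right,
          real_inner_self_eq_norm_sq]
        ring)
  have hsq := ((hψ.sub hS).const_mul 2).sqrt
  refine ⟨_, hsq.congr fun k => ?_⟩
  rw [add_sub_cancel_right, ← mul_assoc, mul_one_div_cancel two_ne_zero, one_mul,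
    Real.sqrt_sq (norm_nonneg _)]

end Scheme

theorem stmt_16
    {H : Type*} [NormedAddCommGroup H] [InnerProductSpace ℝ H] [CompleteSpace H]
    (M : H → Set H) (F : H → H) (L α c γ : ℝ)
    (hM : ∀ z y u' v', u' ∈ M z → v' ∈ M y → 0 ≤ ⟪v' - u', y - z⟫)
    (hFmono : ∀ z y, 0 ≤ ⟪F y - F z, y - z⟫)
    (hL : 0 < L)
    (hFlip : ∀ z y, ‖F y - F z‖ ≤ L * ‖y - z‖)
    (hα : 2 < α) (hcl : α / 2 < c) (hcu : c < α - 1)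
    (hγ0 : 0 < γ) (hγ : γ < 1 / (2 * L))
    (z w ξ v : ℕ → H)
    (hξ : ∀ k : ℕ, 1 ≤ k → ξ k ∈ M (z k))
    (hv : ∀ k : ℕ, 1 ≤ k → v k = ξ k + F (w (k - 1)))
    (hw : ∀ k : ℕ, 1 ≤ k →
      w k = z k + ((k : ℝ) / ((k : ℝ) + α)) • (z k - z (k - 1)) - ((c / ((k : ℝ) + α)) * γ) • v k)
    (hz : ∀ k : ℕ, 1 ≤ k → z (k + 1) = w k - γ • (v (k + 1) - v k))
    (zs : H) (hzs : -F zs ∈ M zs) :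
    ∃ l : ℝ, Tendsto (fun k : ℕ => ‖z k - zs‖) atTop (nhds l) := by
  have hγL : γ * L < 1 / 2 := by
    rw [lt_div_iff₀ (by positivity)] at hγ
    linarith
  refine tendsto_norm_of_scheme (x := fun k => z k - zs) (y := fun k => γ • v k)
    (e := fun k => γ • (F (w (k - 1)) - F (z k))) (κ := γ * L) hcu (by linarith) (by positivity)
    hγL (fun k => ?_) (fun k hk => ?_) (fun k hk => ?_) (fun k hk => ?_)
  · have h1 := hw (k + 1) (by omega)
    have h2 := hz (k + 1) (by omega)
    have hk : ((k : ℝ) + 1 + α) ≠ 0 := by positivity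
    rw [h1, add_tsub_cancel_right] at h2
    push_cast at h2
    rw [show z (k + 2) = z (k + 1 + 1) from rfl, h2]
    match_scalars <;> field_simp <;> ring
  · have h : w k - z (k + 1) = γ • (v (k + 1) - v k) := by rw [hz k hk, sub_sub_cancel]
    rw [add_tsub_cancel_right, norm_smul, Real.norm_of_nonneg hγ0.le, mul_assoc, ← smul_sub, ← h]
    exact mul_le_mul_of_nonneg_left (hFlip _ _) hγ0.le
  · have h : γ • v (k + 1) - γ • v k - γ • (F (w (k + 1 - 1)) - F (z (k + 1)))
        + γ • (F (w (k - 1)) - F (z k))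
        = γ • ((ξ (k + 1) - ξ k) + (F (z (k + 1)) - F (z k))) := by
      rw [hv k hk, hv (k + 1) (by omega)]
      module
    rw [h, sub_sub_sub_cancel_right, real_inner_comm, real_inner_smul_left, inner_add_left]
    exact mul_nonneg hγ0.le (add_nonneg
      (hM _ _ _ _ (hξ k hk) (hξ (k + 1) (by omega))) (hFmono _ _))
  · have h : γ • v k - γ • (F (w (k - 1)) - F (z k))
        = γ • ((ξ k - -F zs) + (F (z k) - F zs)) := by
      rw [hv k hk]
      module
    rw [h, real_inner_comm, real_inner_smul_left, inner_add_left]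
    exact mul_nonneg hγ0.le (add_nonneg (hM _ _ _ _ hzs (hξ k hk)) (hFmono _ _))
end

section
/- Suppose Zer(M+F) is nonempty and let z* ∈ Zer(M+F). Then the series ∑_{k≥1} ⟨z_k − z*, v_k⟩ converges, i.e., the partial sums S_K := ∑_{k=1}^{K} ⟨z_k − z*, v_k⟩ have a finite limit as K → +∞. -/
open scoped RealInnerProductSpace Pointwise
open Filter

namespace FastRFB

variable {H : Type*} [NormedAddCommGroup H] [InnerProductSpace ℝ H]

/-- The Lyapunov function, as a function of the shifted index `τ`, the error `x = z - z*`, the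
scaled velocity `q`, the scaled operator value `g`, the forward error `e` and the increment `y`
of `g`. -/
noncomputable def energy (l b A τ : ℝ) (x q g e y : H) : ℝ :=
  1 / 2 * ‖l • x + q + τ • g‖ ^ 2 + 1 / 2 * (l * b) * ‖x‖ ^ 2
    + A * (1 / 2 * ‖q‖ ^ 2 + τ * ⟪q, e⟫ + 1 / 4 * τ ^ 2 * ‖y‖ ^ 2)

/-- The quadratic form bounding the increment of `energy` along one step of the iteration. -/
noncomputable def remainder (l b A τ : ℝ) (d g e e' y y' : H) : ℝ :=
  -b * (τ + 1 + b / 2) * ‖d + g‖ ^ 2 + b * l * ⟪d, d + g⟫ - 1 / 2 * l * b * ‖d‖ ^ 2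
    + A * (-(b + 1) ^ 2 / 2 * ‖d + g‖ ^ 2 - (l + b) * τ * ‖d‖ ^ 2 + (1 - l) ^ 2 / 2 * ‖d‖ ^ 2
      - 1 / 2 * τ ^ 2 * ‖y‖ ^ 2 - (b + 1) * τ * ⟪d, g⟫ - (b + 1) * τ * ⟪g, y⟫
      + ((1 - l - b) * τ + (1 - l)) * ⟪d, e⟫ - (b + 1) * τ * ⟪g, e'⟫ - τ ^ 2 * ⟪y, e'⟫
      + 1 / 4 * (τ + 1) ^ 2 * ‖y‖ ^ 2 - 1 / 4 * τ ^ 2 * ‖y'‖ ^ 2)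

lemma le_energy {l b A τ r : ℝ} (hA : 0 ≤ A) (hτ : 0 ≤ τ) (hr : r ≤ 1 / 2) (x q g : H) {e y : H}
    (he : ‖e‖ ≤ r * ‖y‖) : 1 / 2 * (l * b) * ‖x‖ ^ 2 ≤ energy l b A τ x q g e y := by
  have he' : ‖e‖ ≤ 1 / 2 * ‖y‖ := he.trans (by gcongr)
  have h1 : -(‖q‖ * (1 / 2 * ‖y‖)) ≤ ⟪q, e⟫ := by
    have := (abs_le.mp (abs_real_inner_le_norm q e)).1
    have := mul_le_mul_of_nonneg_left he' (norm_nonneg q)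
    linarith
  have h2 := mul_le_mul_of_nonneg_left h1 hτ
  have h3 : 0 ≤ 1 / 2 * ‖q‖ ^ 2 + τ * ⟪q, e⟫ + 1 / 4 * τ ^ 2 * ‖y‖ ^ 2 := by
    nlinarith [sq_nonneg (‖q‖ - 1 / 2 * (τ * ‖y‖)), sq_nonneg ‖q‖, sq_nonneg (τ * ‖y‖)]
  have := mul_nonneg hA h3
  unfold energy
  nlinarith [sq_nonneg ‖l • x + q + τ • g‖]

lemma energy_succ_le {l b A τ : ℝ} (hA : 0 ≤ A) (hb : 0 ≤ b) (hτ : 0 ≤ τ) (x d g e e' y y' q : H)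
    (hq : q = (τ + b + 1) • d + (b + 1) • g + τ • y) (hmon : 0 ≤ ⟪d, y - (e - e')⟫) :
    energy l b A (τ + 1) x ((τ + 1 - l) • d) g e y ≤
      energy l b A τ (x - d) q (g - y) e' y' - l * b * ⟪x, g⟫
      + remainder l b A τ d g e e' y y' := by
  have h := mul_nonneg (mul_nonneg hA (mul_nonneg (by linarith : 0 ≤ τ + b + 1) hτ)) hmon
  subst hq
  unfold energy remainder
  simp only [← real_inner_self_eq_norm_sq, inner_add_left, inner_add_right, inner_sub_left,
    inner_sub_right, real_inner_smul_left, real_inner_smul_right] at h ⊢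
  rw [real_inner_comm y d] at h
  rw [real_inner_comm d x, real_inner_comm g x, real_inner_comm y x, real_inner_comm g d,
    real_inner_comm y d, real_inner_comm y g]
  linarith

/-- Young-type absorption of the cross terms for large `τ`. -/
lemma exists_absorb {m ρ M : ℝ} (hm : 0 < m) (hρ : 0 < ρ) (hM : 0 ≤ M) :
    ∃ T : ℝ, 1 ≤ T ∧ ∀ τ, T ≤ τ → ∀ S D Y Z : ℝ,
      -(m * τ) * (S ^ 2 + D ^ 2) + M * (S ^ 2 + D ^ 2) + M * τ * ((S + D) * (Y + Z))
        + M * τ * Y ^ 2 - ρ * τ ^ 2 * (Y ^ 2 + Z ^ 2) ≤ -(ρ / 2 * τ ^ 2 * Y ^ 2) := by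
  set Q := M + 2 * M ^ 2 / m with hQ
  refine ⟨max 1 (max (2 * M / m) (2 * Q / ρ)), le_max_left _ _, fun τ hτ S D Y Z => ?_⟩
  obtain ⟨h1, h2⟩ := max_le_iff.mp hτ
  obtain ⟨h2, h3⟩ := max_le_iff.mp h2
  rw [div_le_iff₀ hm] at h2
  rw [div_le_iff₀ hρ] at h3
  have key : M * ((S + D) * (Y + Z)) ≤
      m / 2 * (S ^ 2 + D ^ 2) + 2 * M ^ 2 / m * (Y ^ 2 + Z ^ 2) := by
    have e : m / 2 * (S ^ 2 + D ^ 2) + 2 * M ^ 2 / m * (Y ^ 2 + Z ^ 2) - M * ((S + D) * (Y + Z))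
        = m * (1 / 4 * (S - D) ^ 2 + 1 / 4 * ((S + D) - 2 * (M / m) * (Y + Z)) ^ 2
          + (M / m) ^ 2 * (Y - Z) ^ 2) := by
      field_simp
      ring
    have : 0 ≤ m * (1 / 4 * (S - D) ^ 2 + 1 / 4 * ((S + D) - 2 * (M / m) * (Y + Z)) ^ 2
          + (M / m) ^ 2 * (Y - Z) ^ 2) := by positivity
    linarith
  have hτ0 : 0 ≤ τ := by linarith
  have k1 := mul_le_mul_of_nonneg_left key hτ0
  have k2 : M * (S ^ 2 + D ^ 2) ≤ m / 2 * τ * (S ^ 2 + D ^ 2) := by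
    gcongr; linarith
  have k3 : Q * τ * (Y ^ 2 + Z ^ 2) ≤ ρ / 2 * τ * τ * (Y ^ 2 + Z ^ 2) := by
    gcongr; linarith
  have k4 : 0 ≤ M * τ * Z ^ 2 := by positivity
  have k5 : 0 ≤ ρ / 2 * τ ^ 2 * Z ^ 2 := by positivity
  rw [hQ] at k3
  linarith

/-- Scalar form of the bound on `remainder`, with the norms and inner products as variables. -/
lemma remainder_scalar_le {l b κ r A m M τ S D Y Z de ds gy ge ye : ℝ} (hl : 0 < l) (hb : 0 < b)
    (hlb : l + b = κ + b + 1) (hA : 0 < A) (hAc : A * (b + 1) ^ 2 = b * κ)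
    (hm1 : 2 * m ≤ b) (hm2 : 2 * m ≤ A * κ)
    (hM : M = b * l + A * ((1 - l) ^ 2 + (b + 1) + (l + b + 1) + (l + 1) + 1)) (hτ1 : 1 ≤ τ)
    (hS0 : 0 ≤ S) (hD0 : 0 ≤ D) (hY0 : 0 ≤ Y) (hZ0 : 0 ≤ Z) (hds : -(D * S) ≤ ds ∧ ds ≤ D * S)
    (hgy : -((S + D) * Y) ≤ gy) (hge : -((S + D) * Z) ≤ ge)
    (hye : -(r / 2 * (Y ^ 2 + Z ^ 2)) ≤ ye)
    (hde2 : ((1 - l - b) * τ + (1 - l)) * de ≤ (((l + b + 1) + (l + 1)) * τ) * (D * Y)) :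
    -b * (τ + 1 + b / 2) * S ^ 2 + b * l * ds - 1 / 2 * l * b * D ^ 2
      + A * (-(b + 1) ^ 2 / 2 * S ^ 2 - (l + b) * τ * D ^ 2 + (1 - l) ^ 2 / 2 * D ^ 2
        - 1 / 2 * τ ^ 2 * Y ^ 2 - (b + 1) * τ * (ds - D ^ 2) - (b + 1) * τ * gy
        + ((1 - l - b) * τ + (1 - l)) * de - (b + 1) * τ * ge - τ ^ 2 * ye
        + 1 / 4 * (τ + 1) ^ 2 * Y ^ 2 - 1 / 4 * τ ^ 2 * Z ^ 2) ≤
    -(m * τ) * (S ^ 2 + D ^ 2) + M * (S ^ 2 + D ^ 2) + M * τ * ((S + D) * (Y + Z))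
        + M * τ * Y ^ 2 - A * ((1 / 2 - r) / 2) * τ ^ 2 * (Y ^ 2 + Z ^ 2) := by
  have hτ0 : 0 ≤ τ := by linarith
  have t1 : b * l * ds ≤ b * l * (S ^ 2 + D ^ 2) := by
    gcongr
    linarith [sq_nonneg (S - D), sq_nonneg (S + D), hds.2]
  have t2 : τ * (-(A * (b + 1) * ds)) ≤ τ * (b / 2 * S ^ 2 + A * κ / 2 * D ^ 2) := by
    gcongr
    have h1 : A * (b + 1) * -ds ≤ A * (b + 1) * (D * S) := by
      gcongr
      linarith
    have h2 : b * (b / 2 * S ^ 2 + A * κ / 2 * D ^ 2 - A * (b + 1) * (D * S))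
        = 1 / 2 * (b * S - A * (b + 1) * D) ^ 2 := by
      linear_combination (-(A / 2) * D ^ 2) * hAc
    have h3 : 0 ≤ b / 2 * S ^ 2 + A * κ / 2 * D ^ 2 - A * (b + 1) * (D * S) :=
      nonneg_of_mul_nonneg_right (h2 ▸ by positivity) hb
    linarith
  have t3 := mul_le_mul_of_nonneg_left hgy (by positivity : 0 ≤ A * ((b + 1) * τ))
  have t4 := mul_le_mul_of_nonneg_left hge (by positivity : 0 ≤ A * ((b + 1) * τ))
  have t5 := mul_le_mul_of_nonneg_left hye (by positivity : 0 ≤ A * τ ^ 2)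
  have t6 := mul_le_mul_of_nonneg_left hde2 hA.le
  have t7 : m * τ * (S ^ 2 + D ^ 2) ≤ τ * (b / 2 * S ^ 2 + A * κ / 2 * D ^ 2) := by
    have h1 := mul_le_mul_of_nonneg_right hm1 (mul_nonneg hτ0 (sq_nonneg S))
    have h2 := mul_le_mul_of_nonneg_right hm2 (mul_nonneg hτ0 (sq_nonneg D))
    linarith
  have t8 : A * (((l + b + 1) + (l + 1)) * τ * (D * Y)) ≤
      A * (((l + b + 1) + (l + 1)) * τ * ((S + D) * (Y + Z))) := by
    gcongr <;> linarith
  have t9 : A * (1 / 4 * (τ + 1) ^ 2 * Y ^ 2) ≤ A * (1 / 4 * τ ^ 2 * Y ^ 2) + A * τ * Y ^ 2 := by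
    have : 0 ≤ A * (τ - 1) * Y ^ 2 := mul_nonneg (mul_nonneg hA.le (by linarith)) (sq_nonneg _)
    have : 0 ≤ A * Y ^ 2 := by positivity
    linarith
  have u1 : A * τ * Y ^ 2 ≤ M * τ * Y ^ 2 := by
    gcongr
    have : 0 ≤ b * l + A * ((1 - l) ^ 2 + (b + 1) + (l + b + 1) + (l + 1)) := by positivity
    rw [hM]; linarith
  have u2 : A * ((b + 1) + (l + b + 1) + (l + 1)) * (τ * ((S + D) * (Y + Z))) ≤
      M * (τ * ((S + D) * (Y + Z))) := by
    gcongr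
    have : 0 ≤ b * l + A * ((1 - l) ^ 2 + 1) := by positivity
    rw [hM]; linarith
  have u3 : b * l * (S ^ 2 + D ^ 2) + A * (1 - l) ^ 2 / 2 * D ^ 2 ≤ M * (S ^ 2 + D ^ 2) := by
    have h1 : A * (1 - l) ^ 2 / 2 * D ^ 2 ≤ A * (1 - l) ^ 2 * (S ^ 2 + D ^ 2) := by
      have : 0 ≤ A * (1 - l) ^ 2 * (S ^ 2 + D ^ 2 / 2) := by positivity
      linarith
    have h2 : 0 ≤ A * ((b + 1) + (l + b + 1) + (l + 1) + 1) * (S ^ 2 + D ^ 2) := by positivity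
    rw [hM]; linarith
  have u4 : 0 ≤ b * (1 + b / 2) * S ^ 2 + 1 / 2 * l * b * D ^ 2 + A * ((b + 1) ^ 2 / 2) * S ^ 2 := by
    positivity
  have e1 : A * (l + b) * τ * D ^ 2 = A * (κ + b + 1) * τ * D ^ 2 := by rw [hlb]
  linarith

/-- The remainder in `energy_succ_le` is dissipative for large `τ`. -/
lemma exists_remainder_le {l b κ r : ℝ} (hl : 0 < l) (hb : 0 < b) (hκ : 0 < κ)
    (hlb : l + b = κ + b + 1) (hr0 : 0 ≤ r) (hr : r < 1 / 2) :
    ∃ A > 0, ∃ η > 0, ∃ T : ℝ, 1 ≤ T ∧ ∀ τ, T ≤ τ → ∀ d g e e' y y' : H,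
      ‖e‖ ≤ r * ‖y‖ → ‖e'‖ ≤ r * ‖y'‖ →
      remainder l b A τ d g e e' y y'
        ≤ -(η * τ ^ 2 * ‖y‖ ^ 2) := by
  set A := b * κ / (b + 1) ^ 2 with hAdef
  have hA : 0 < A := by positivity
  have hAc : A * (b + 1) ^ 2 = b * κ := by rw [hAdef]; field_simp
  set m := min b (A * κ) / 2 with hmdef
  have hm : 0 < m := by positivity
  have hm1 : 2 * m ≤ b := by rw [hmdef]; linarith [min_le_left b (A * κ)]
  have hm2 : 2 * m ≤ A * κ := by rw [hmdef]; linarith [min_le_right b (A * κ)]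
  set M := b * l + A * ((1 - l) ^ 2 + (b + 1) + (l + b + 1) + (l + 1) + 1) with hM
  have hM0 : 0 ≤ M := by positivity
  clear_value A m M
  have hρ : 0 < A * ((1 / 2 - r) / 2) := by
    have : 0 < 1 / 2 - r := by linarith
    positivity
  obtain ⟨T, hT1, hT⟩ := exists_absorb hm hρ hM0
  refine ⟨A, hA, A * ((1 / 2 - r) / 2) / 2, by positivity, T, hT1, ?_⟩
  intro τ hτ d g e e' y y' he he'
  refine le_trans ?_ (hT τ hτ ‖d + g‖ ‖d‖ ‖y‖ ‖y'‖)
  unfold remainder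
  have hτ1 : 1 ≤ τ := hT1.trans hτ
  have hg : ‖g‖ ≤ ‖d + g‖ + ‖d‖ := by
    simpa using norm_sub_le (d + g) d
  have hdg : ⟪d, g⟫ = ⟪d, d + g⟫ - ‖d‖ ^ 2 := by
    rw [inner_add_right, real_inner_self_eq_norm_sq]; ring
  have hds := abs_le.mp (abs_real_inner_le_norm d (d + g))
  rw [hdg]
  have hgy : -((‖d + g‖ + ‖d‖) * ‖y‖) ≤ ⟪g, y⟫ := by
    have := (abs_le.mp (abs_real_inner_le_norm g y)).1
    have := mul_le_mul_of_nonneg_right hg (norm_nonneg y)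
    linarith
  have he1 : ‖e‖ ≤ ‖y‖ := he.trans (by nlinarith [norm_nonneg y])
  have he1' : ‖e'‖ ≤ ‖y'‖ := he'.trans (by nlinarith [norm_nonneg y'])
  have hge : -((‖d + g‖ + ‖d‖) * ‖y'‖) ≤ ⟪g, e'⟫ := by
    have := (abs_le.mp (abs_real_inner_le_norm g e')).1
    have := mul_le_mul hg he1' (norm_nonneg _) (by positivity)
    linarith
  have hye : -(r / 2 * (‖y‖ ^ 2 + ‖y'‖ ^ 2)) ≤ ⟪y, e'⟫ := by
    have h1 := (abs_le.mp (abs_real_inner_le_norm y e')).1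
    have h2 := mul_le_mul_of_nonneg_left he' (norm_nonneg y)
    nlinarith [mul_nonneg hr0 (sq_nonneg (‖y‖ - ‖y'‖))]
  have hde : |⟪d, e⟫| ≤ ‖d‖ * ‖y‖ :=
    (abs_real_inner_le_norm d e).trans (by gcongr)
  have hcoef : |(1 - l - b) * τ + (1 - l)| ≤ ((l + b + 1) + (l + 1)) * τ := by
    have h1 : l * 1 ≤ l * τ := by gcongr
    have h2 : 0 ≤ b * τ := by positivity
    rw [abs_le]
    constructor <;> linarith
  have hde2 : ((1 - l - b) * τ + (1 - l)) * ⟪d, e⟫ ≤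
      (((l + b + 1) + (l + 1)) * τ) * (‖d‖ * ‖y‖) := by
    refine (le_abs_self _).trans ?_
    rw [abs_mul]
    gcongr
  exact remainder_scalar_le hl hb hlb hA hAc hm1 hm2 hM hτ1 (norm_nonneg _) (norm_nonneg _)
    (norm_nonneg _) (norm_nonneg _) hds hgy hge hye hde2

/-- A quasi-Fejér type lemma with relative errors of order `1 / n ^ 2`. -/
lemma bounded_and_summable_of_le {E a : ℕ → ℝ} {C : ℝ} (hC : 0 ≤ C) (N : ℕ)
    (hE : ∀ n ≥ N, 0 ≤ E n) (ha : ∀ n ≥ N, 0 ≤ a n)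
    (h : ∀ n ≥ N, E (n + 1) + a n ≤ E n + C / (n : ℝ) ^ 2 * E (n + 1)) :
    (∃ B, ∀ᶠ n in atTop, E n ≤ B) ∧ Summable a := by
  obtain ⟨N', hN'⟩ := exists_nat_ge (max 1 (4 * C))
  set N₀ := max N N'
  have step : ∀ n ≥ N₀, (1 + 4 * C / ((n + 1 : ℕ) : ℝ)) * E (n + 1) + a n
      ≤ (1 + 4 * C / (n : ℝ)) * E n := by
    intro n hn
    have hnN : N ≤ n := (le_max_left _ _).trans hn
    have hn' : max 1 (4 * C) ≤ (n : ℝ) :=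
      hN'.trans (by exact_mod_cast (le_max_right N N').trans hn)
    obtain ⟨h1, h4⟩ := max_le_iff.mp hn'
    have hn0 : (0 : ℝ) < n := by linarith
    have h1' := mul_le_mul_of_nonneg_left (h n hnN) (by positivity : 0 ≤ 1 + 4 * C / (n : ℝ))
    have h2 : 1 + 4 * C / ((n : ℝ) + 1) ≤ (1 + 4 * C / (n : ℝ)) * (1 - C / (n : ℝ) ^ 2) := by
      have : (1 + 4 * C / (n : ℝ)) * (1 - C / (n : ℝ) ^ 2) - (1 + 4 * C / ((n : ℝ) + 1))
          = C * (4 * n ^ 2 - (n + 4 * C) * (n + 1)) / (n ^ 3 * (n + 1)) := by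
        field_simp
        ring
      have : 0 ≤ C * (4 * n ^ 2 - (n + 4 * C) * (n + 1)) / ((n : ℝ) ^ 3 * (n + 1)) := by
        apply div_nonneg (mul_nonneg hC ?_) (by positivity)
        nlinarith
      linarith
    have h3 := mul_le_mul_of_nonneg_right h2 (hE (n + 1) (by omega))
    have h5 : 0 ≤ 4 * C / (n : ℝ) * a n := mul_nonneg (by positivity) (ha n hnN)
    push_cast
    linarith
  have nonneg : ∀ n ≥ N₀, 0 ≤ (1 + 4 * C / (n : ℝ)) * E n := fun n hn =>
    mul_nonneg (by positivity) (hE n ((le_max_left _ _).trans hn))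
  have sums : ∀ j, (1 + 4 * C / ((j + N₀ : ℕ) : ℝ)) * E (j + N₀)
      + ∑ i ∈ Finset.range j, a (i + N₀) ≤ (1 + 4 * C / (N₀ : ℝ)) * E N₀ := by
    intro j
    induction j with
    | zero => simp
    | succ j ih =>
      have := step (j + N₀) (by omega)
      rw [Finset.sum_range_succ, show j + 1 + N₀ = j + N₀ + 1 by omega]
      linarith
  have apos : ∀ i, 0 ≤ a (i + N₀) := fun i =>
    ha _ ((le_max_left N N').trans (Nat.le_add_left _ _))
  constructor
  · refine ⟨(1 + 4 * C / (N₀ : ℝ)) * E N₀, eventually_atTop.mpr ⟨N₀, fun n hn => ?_⟩⟩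
    have h1 := sums (n - N₀)
    rw [Nat.sub_add_cancel hn] at h1
    have h2 := Finset.sum_nonneg (s := Finset.range (n - N₀)) fun i _ => apos i
    have h3 : 0 ≤ 4 * C / (n : ℝ) * E n :=
      mul_nonneg (by positivity) (hE n ((le_max_left _ _).trans hn))
    linarith
  · rw [← summable_nat_add_iff N₀]
    refine summable_of_sum_range_le (c := (1 + 4 * C / (N₀ : ℝ)) * E N₀) apos fun j => ?_
    linarith [sums j, nonneg (j + N₀) (by omega)]

lemma summable_of_energy_step {E P Y X G : ℕ → ℝ} {β η : ℝ} (hβ : 0 < β) (hη : 0 < η) (N : ℕ)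
    (hN : 1 ≤ N) (hE : ∀ n ≥ N, 1 / 2 * β * X n ^ 2 ≤ E n) (hP : ∀ n ≥ N, 0 ≤ P n)
    (hG : ∀ n ≥ N, |G n - P n| ≤ X n * Y n)
    (h : ∀ n ≥ N, E (n + 1) ≤ E n - β * G (n + 1) - η * (n : ℝ) ^ 2 * Y (n + 1) ^ 2) :
    Summable G := by
  set a : ℕ → ℝ := fun n => β * P (n + 1) + η / 2 * (n : ℝ) ^ 2 * Y (n + 1) ^ 2 with ha
  have young : ∀ n ≥ N, ∀ s > 0, X (n + 1) * Y (n + 1) ≤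
      s / 2 * (n : ℝ) ^ 2 * Y (n + 1) ^ 2 + 1 / (2 * s) / (n : ℝ) ^ 2 * X (n + 1) ^ 2 := by
    intro n hn s hs
    have hn0 : (0 : ℝ) < n := by exact_mod_cast hN.trans hn
    have : s / 2 * (n : ℝ) ^ 2 * Y (n + 1) ^ 2 + 1 / (2 * s) / (n : ℝ) ^ 2 * X (n + 1) ^ 2
        - X (n + 1) * Y (n + 1) = s / 2 * (n * Y (n + 1) - X (n + 1) / (s * n)) ^ 2 := by
      field_simp
      ring
    have : 0 ≤ s / 2 * (n * Y (n + 1) - X (n + 1) / (s * n)) ^ 2 := by positivity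
    linarith
  have ha0 : ∀ n ≥ N, 0 ≤ a n := fun n hn =>
    add_nonneg (mul_nonneg hβ.le (hP _ (by omega))) (by positivity)
  obtain ⟨⟨B, hB⟩, hsum⟩ := bounded_and_summable_of_le (E := E) (a := a) (C := β / η)
    (by positivity) N (fun n hn => le_trans (by positivity) (hE n hn)) ha0 (by
      intro n hn
      have hn0 : (0 : ℝ) < n := by exact_mod_cast hN.trans hn
      have h1 := young n hn (η / β) (by positivity)
      have h2 := (abs_le.mp (hG (n + 1) (by omega))).1
      have h3 : β / η / (n : ℝ) ^ 2 * (1 / 2 * β * X (n + 1) ^ 2) ≤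
          β / η / (n : ℝ) ^ 2 * E (n + 1) := by
        gcongr
        exact hE (n + 1) (by omega)
      have h4 := mul_le_mul_of_nonneg_left h1 hβ.le
      have h5 : β * (η / β / 2 * (n : ℝ) ^ 2 * Y (n + 1) ^ 2
          + 1 / (2 * (η / β)) / (n : ℝ) ^ 2 * X (n + 1) ^ 2) =
          η / 2 * (n : ℝ) ^ 2 * Y (n + 1) ^ 2
          + β / η / (n : ℝ) ^ 2 * (1 / 2 * β * X (n + 1) ^ 2) := by
        field_simp
      have h6 := h n hn
      have h7 := mul_le_mul_of_nonneg_left h2 hβ.le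
      simp only [ha]
      linarith)
  rw [← summable_nat_add_iff 1]
  have hs2 : Summable fun n : ℕ => B / β * (1 / (n : ℝ) ^ 2) :=
    (Real.summable_one_div_nat_pow.mpr (by norm_num)).mul_left _
  refine Summable.of_norm_bounded_eventually_nat
    ((hsum.mul_left (1 / β + 1 / η)).add hs2) ?_
  filter_upwards [eventually_ge_atTop N, (tendsto_add_atTop_nat 1).eventually hB] with n hn hBn
  have hn0 : (0 : ℝ) < n := by exact_mod_cast hN.trans hn
  have h1 := young n hn 1 one_pos
  have h2 := abs_le.mp (hG (n + 1) (by omega))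
  have h3 := hP (n + 1) (by omega)
  have h4 : 1 / (2 * 1) / (n : ℝ) ^ 2 * X (n + 1) ^ 2 ≤ B / β * (1 / (n : ℝ) ^ 2) := by
    have : 1 / (2 * 1) / (n : ℝ) ^ 2 * X (n + 1) ^ 2
        = (1 / 2 * β * X (n + 1) ^ 2) / β * (1 / (n : ℝ) ^ 2) := by field_simp
    rw [this]
    gcongr
    exact (hE (n + 1) (by omega)).trans hBn
  have h5 : (1 / β + 1 / η) * a n = P (n + 1) + 1 / 2 * (n : ℝ) ^ 2 * Y (n + 1) ^ 2
      + β / η * P (n + 1) + η / (2 * β) * (n : ℝ) ^ 2 * Y (n + 1) ^ 2 := by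
    simp only [ha]
    field_simp
    ring
  have h6 : 0 ≤ β / η * P (n + 1) := by positivity
  have h7 : 0 ≤ η / (2 * β) * (n : ℝ) ^ 2 * Y (n + 1) ^ 2 := by positivity
  rw [Real.norm_eq_abs, h5, abs_le]
  constructor <;> linarith

end FastRFB

theorem stmt_17
    {H : Type*} [NormedAddCommGroup H] [InnerProductSpace ℝ H] [CompleteSpace H]
    (M : H → Set H) (F : H → H) (L α c γ : ℝ)
    (hM : ∀ z y u' v', u' ∈ M z → v' ∈ M y → 0 ≤ ⟪v' - u', y - z⟫)
    (hFmono : ∀ z y, 0 ≤ ⟪F y - F z, y - z⟫)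
    (hL : 0 < L)
    (hFlip : ∀ z y, ‖F y - F z‖ ≤ L * ‖y - z‖)
    (hα : 2 < α) (hcl : α / 2 < c) (hcu : c < α - 1)
    (hγ0 : 0 < γ) (hγ : γ < 1 / (2 * L))
    (z w ξ v : ℕ → H)
    (hξ : ∀ k : ℕ, 1 ≤ k → ξ k ∈ M (z k))
    (hv : ∀ k : ℕ, 1 ≤ k → v k = ξ k + F (w (k - 1)))
    (hw : ∀ k : ℕ, 1 ≤ k →
      w k = z k + ((k : ℝ) / ((k : ℝ) + α)) • (z k - z (k - 1)) - ((c / ((k : ℝ) + α)) * γ) • v k)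
    (hz : ∀ k : ℕ, 1 ≤ k → z (k + 1) = w k - γ • (v (k + 1) - v k))
    (zs : H) (hzs : -F zs ∈ M zs) :
    ∃ S : ℝ, Tendsto (fun K : ℕ => ∑ k ∈ Finset.Icc 1 K, ⟪z k - zs, v k⟫) atTop (nhds S) := by
  have hr0 : 0 ≤ γ * L := by positivity
  have hr : γ * L < 1 / 2 := by
    rw [lt_div_iff₀ (by positivity)] at hγ
    linarith
  obtain ⟨A, hA, η, hη, T, hT1, hT⟩ := FastRFB.exists_remainder_le (H := H) (l := α - c)
    (b := c - 1) (κ := α - 1 - c) (r := γ * L) (by linarith) (by linarith) (by linarith)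
    (by ring) hr0 hr
  obtain ⟨N', hN'⟩ := exists_nat_ge T
  set N := max 2 N'
  let g : ℕ → H := fun k => γ • v k
  let e : ℕ → H := fun k => γ • (F (w (k - 1)) - F (z k))
  let y : ℕ → H := fun k => g k - g (k - 1)
  have he : ∀ n ≥ 2, ‖e n‖ ≤ γ * L * ‖y n‖ := by
    intro n hn
    obtain ⟨k, rfl⟩ : ∃ k, n = k + 1 := ⟨n - 1, by omega⟩
    have h1 : w k - z (k + 1) = y (k + 1) := by
      simp only [y, g, Nat.add_sub_cancel, hz k (by omega), smul_sub]
      abel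
    simp only [e, Nat.add_sub_cancel, norm_smul, Real.norm_eq_abs, abs_of_pos hγ0]
    have h2 := mul_le_mul_of_nonneg_left (hFlip (z (k + 1)) (w k)) hγ0.le
    rw [h1] at h2
    linarith
  have hge : ∀ n ≥ 1, g n - e n = γ • (ξ n + F (z n)) := by
    intro n hn
    simp only [g, e, hv n hn, ← smul_sub]
    congr 1
    abel
  have hmon : ∀ n ≥ 1, 0 ≤ ⟪z (n + 1) - z n, y (n + 1) - (e (n + 1) - e n)⟫ := by
    intro n hn
    have h1 : y (n + 1) - (e (n + 1) - e n)
        = γ • ((ξ (n + 1) - ξ n) + (F (z (n + 1)) - F (z n))) := by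
      have : y (n + 1) - (e (n + 1) - e n) = (g (n + 1) - e (n + 1)) - (g n - e n) := by
        simp only [y, Nat.add_sub_cancel]
        abel
      rw [this, hge n hn, hge (n + 1) (by omega), ← smul_sub]
      congr 1
      abel
    rw [h1, real_inner_smul_right, real_inner_comm, inner_add_left]
    exact mul_nonneg hγ0.le (add_nonneg (hM _ _ _ _ (hξ n hn) (hξ (n + 1) (by omega)))
      (hFmono _ _))
  have hP : ∀ n ≥ 1, 0 ≤ ⟪z n - zs, g n - e n⟫ := by
    intro n hn
    have h1 : ξ n + F (z n) = (ξ n - -F zs) + (F (z n) - F zs) := by abel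
    rw [hge n hn, h1, real_inner_smul_right, real_inner_comm, inner_add_left]
    exact mul_nonneg hγ0.le (add_nonneg (hM _ _ _ _ hzs (hξ n hn)) (hFmono _ _))
  have hrec : ∀ n : ℕ, 1 ≤ n → (n : ℝ) • (z n - z (n - 1)) = ((n : ℝ) + (α - c) + (c - 1) + 1) •
      (z (n + 1) - z n) + (c - 1 + 1) • g (n + 1) + ((n : ℝ) + (α - c)) • y (n + 1) := by
    intro n hn
    have hpos : (n : ℝ) + α ≠ 0 := by positivity
    have h1 : z (n + 1) - z n = ((n : ℝ) / ((n : ℝ) + α)) • (z n - z (n - 1))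
        - ((c / ((n : ℝ) + α)) * γ) • v n - γ • (v (n + 1) - v n) := by
      rw [hz n hn, hw n hn]
      abel
    rw [h1]
    simp only [g, y, Nat.add_sub_cancel]
    match_scalars <;> field_simp <;> ring
  have hTN : ∀ n ≥ N, T ≤ (n : ℝ) := fun n hn =>
    hN'.trans (by exact_mod_cast (le_max_right 2 N').trans hn)
  have h2N : 2 ≤ N := le_max_left _ _
  have hsum : Summable fun n => ⟪z n - zs, g n⟫ := by
    refine FastRFB.summable_of_energy_step (β := (α - c) * (c - 1)) (η := η) (N := N)
      (E := fun n => FastRFB.energy (α - c) (c - 1) A ((n : ℝ) + (α - c)) (z n - zs)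
        ((n : ℝ) • (z n - z (n - 1))) (g n) (e n) (y n))
      (P := fun n => ⟪z n - zs, g n - e n⟫) (Y := fun n => ‖y n‖) (X := fun n => ‖z n - zs‖)
      (mul_pos (by linarith) (by linarith)) hη (by omega) ?_ ?_ ?_ ?_
    · intro n hn
      have : (0 : ℝ) ≤ n := Nat.cast_nonneg n
      exact FastRFB.le_energy hA.le (by linarith) hr.le _ _ _ (he n (by omega))
    · exact fun n hn => hP n (by omega)
    · intro n hn
      have h1 : ⟪z n - zs, g n⟫ - ⟪z n - zs, g n - e n⟫ = ⟪z n - zs, e n⟫ := by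
        rw [← inner_sub_right, sub_sub_cancel]
      simp only [h1]
      refine (abs_real_inner_le_norm _ _).trans ?_
      gcongr
      refine (he n (by omega)).trans ?_
      nlinarith [norm_nonneg (y n)]
    · intro n hn
      have hTn := hTN n hn
      have h1 := FastRFB.energy_succ_le (l := α - c) (b := c - 1) (A := A)
        (τ := (n : ℝ) + (α - c)) hA.le (by linarith) (by linarith) (z (n + 1) - zs)
        (z (n + 1) - z n) (g (n + 1)) (e (n + 1)) (e n) (y (n + 1)) (y n)
        ((n : ℝ) • (z n - z (n - 1))) (hrec n (by omega)) (hmon n (by omega))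
      have h2 := hT ((n : ℝ) + (α - c)) (by linarith) (z (n + 1) - z n) (g (n + 1))
        (e (n + 1)) (e n) (y (n + 1)) (y n) (he _ (by omega)) (he _ (by omega))
      have h3 : η * (n : ℝ) ^ 2 * ‖y (n + 1)‖ ^ 2 ≤
          η * ((n : ℝ) + (α - c)) ^ 2 * ‖y (n + 1)‖ ^ 2 := by
        gcongr
        linarith
      have h4 : g (n + 1) - y (n + 1) = g n := by simp [y]
      have h5 : z (n + 1) - zs - (z (n + 1) - z n) = z n - zs := by abel
      rw [h4, h5] at h1
      have h6 : (n : ℝ) + (α - c) + 1 - (α - c) = ((n + 1 : ℕ) : ℝ) := by push_cast; ring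
      have h7 : (n : ℝ) + (α - c) + 1 = ((n + 1 : ℕ) : ℝ) + (α - c) := by push_cast; ring
      rw [h6, h7] at h1
      simp only [Nat.add_sub_cancel]
      linarith
  have hsum' : Summable fun n => ⟪z (n + 1) - zs, v (n + 1)⟫ := by
    refine (((summable_nat_add_iff 1).mpr hsum).mul_left γ⁻¹).congr fun n => ?_
    simp only [g, real_inner_smul_right]
    field_simp
  refine ⟨_, hsum'.hasSum.tendsto_sum_nat.congr fun K => ?_⟩
  rw [Finset.range_eq_Ico, Finset.sum_Ico_add' (fun k => ⟪z k - zs, v k⟫) 0 K 1]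
  rfl
end

section
/- Suppose Zer(M+F) is nonempty and let z* ∈ Zer(M+F). Then the series ∑_{k≥2} |⟨z_k − z*, F(w_{k−1}) − F(z_k)⟩| converges; in particular, the series ∑_{k≥2} ⟨z_k − z*, F(w_{k−1}) − F(z_k)⟩ is absolutely convergent. -/
open scoped RealInnerProductSpace Pointwise
open Filter

/-- Discrete Lyapunov function of the Fast RFB iteration; `D` stands for `k • (z_k - z_{k-1})` and
`δ` for the increment of `g`. -/
noncomputable def fastRFBEnergy {H : Type*} [NormedAddCommGroup H] [InnerProductSpace ℝ H]
    (α k : ℝ) (x D g e δ : H) : ℝ :=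
  ‖α • x + (2 : ℝ) • D + k • g‖ ^ 2 / 2 + α * (α / 2 - 1) * ‖x‖ ^ 2 + α * k * ⟪x, g⟫
    + k ^ 2 * ‖g‖ ^ 2 / 2 - 2 * k * ⟪D, e⟫ + k ^ 2 * ‖δ‖ ^ 2 / 2

theorem le_fastRFBEnergy {H : Type*} [NormedAddCommGroup H] [InnerProductSpace ℝ H]
    {α k : ℝ} {x D g e δ : H} (hα : 0 ≤ α) (hk : 0 ≤ k) (hx : 0 ≤ ⟪x, g + e⟫)
    (he : ‖e‖ ≤ 1 / 2 * ‖δ‖) :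
    α * (α / 2 - 1) * ‖x‖ ^ 2 ≤ fastRFBEnergy α k x D g e δ := by
  set y : H := (α / 2) • x + D with hy
  have expand : fastRFBEnergy α k x D g e δ = α * (α / 2 - 1) * ‖x‖ ^ 2 + ‖y‖ ^ 2
      + ‖y + k • g‖ ^ 2 + α * k * ⟪x, g + e⟫ - 2 * k * ⟪y, e⟫ + k ^ 2 * ‖δ‖ ^ 2 / 2 := by
    simp only [fastRFBEnergy, hy, ← real_inner_self_eq_norm_sq, inner_add_left, inner_add_right,
      real_inner_smul_left, real_inner_smul_right, real_inner_comm x D, real_inner_comm x g,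
      real_inner_comm D g]
    ring
  have hye : ⟪y, e⟫ ≤ ‖y‖ * (1 / 2 * ‖δ‖) :=
    (real_inner_le_norm y e).trans (mul_le_mul_of_nonneg_left he (norm_nonneg y))
  have h₁ := mul_le_mul_of_nonneg_left hye (mul_nonneg zero_le_two hk)
  have h₂ : 0 ≤ α * k * ⟪x, g + e⟫ := by positivity
  nlinarith [sq_nonneg (‖y‖ - k * ‖δ‖), sq_nonneg ‖y + k • g‖, sq_nonneg ‖y‖,
    sq_nonneg (k * ‖δ‖)]

/-- Exact expansion of the energy decrement along one step of the iteration. -/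
theorem fastRFBEnergy_succ_sub {H : Type*} [NormedAddCommGroup H] [InnerProductSpace ℝ H]
    (α c k : ℝ) (x d g δ e e' δ' : H) :
    fastRFBEnergy α (k + 1) x ((k + 1) • d) g e δ
      - fastRFBEnergy α k (x - d) ((k + α) • d + c • (g - δ) + (k + α) • δ) (g - δ) e' δ' =
    -(2 * k ^ 2 * ⟪δ + e - e', d⟫) - 2 * α * (c - 1) * ⟪x, g + e⟫
      - ‖(α - 2) • d + (2 * c - 1) • g + (2 * α - 2 * c) • δ‖ ^ 2 / 2
      - k * ((2 * α - 2 - 2 * c) * ‖d‖ ^ 2 + 2 * (c - 1) * ‖d + g‖ ^ 2)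
      - k ^ 2 * (‖δ‖ ^ 2 + ‖δ'‖ ^ 2) / 2 + 2 * k ^ 2 * ⟪δ, e'⟫
      + 2 * α * (c - 1) * ⟪x, e⟫ - α * (2 * α - 2 * c) * ⟪x, δ⟫
      - (2 * α - 4 + α * (α / 2 - 1)) * ‖d‖ ^ 2 - (4 * c - 4 + α) * ⟪d, g⟫
      - (2 * c - 3 / 2) * ‖g‖ ^ 2
      - (2 * (k * (1 + 2 * α - 2 * c) + 2 * α - 2 * c) + (2 * α - 2) * k) * ⟪d, δ⟫
      - (k * (2 * α) + 2 * α - 2 * c) * ⟪g, δ⟫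
      + (k + 1 / 2 - (2 * α - 2 * c) * k) * ‖δ‖ ^ 2
      - (4 * k + 2) * ⟪d, e⟫
      + 2 * k * (α * ⟪d, e'⟫ + c * ⟪g, e'⟫ + (α - c) * ⟪δ, e'⟫) := by
  simp only [fastRFBEnergy, ← real_inner_self_eq_norm_sq, inner_add_left, inner_add_right,
    inner_sub_left, inner_sub_right,
    real_inner_smul_left, real_inner_smul_right, real_inner_comm x d, real_inner_comm x g,
    real_inner_comm x δ, real_inner_comm d g, real_inner_comm d δ, real_inner_comm g δ,
    real_inner_comm d e, real_inner_comm d e']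
  ring

theorem mul_le_mul_of_abs_le {A B p q : ℝ} (hA : |A| ≤ B) (hp : |p| ≤ q) : A * p ≤ B * q :=
  (le_abs_self _).trans <| (abs_mul A p).trans_le <|
    mul_le_mul hA hp (abs_nonneg p) ((abs_nonneg A).trans hA)

theorem cross_terms_le {α k a b t s : ℝ} (hα : 2 ≤ α) (hk : 1 ≤ k) (ha : 0 ≤ a) (hb : 0 ≤ b)
    (ht : 0 ≤ t) (hs : 0 ≤ s) :
    3 * α ^ 2 * (a * b) + 5 * α ^ 2 * k * (a * t)
      + 2 * α ^ 2 * k * (b * t) + 6 * k * (a * (1 / 2 * t))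
      + 2 * k * α * (a * (1 / 2 * s)) + 2 * k * α * (b * (1 / 2 * s))
      + 2 * k * α * (t * (1 / 2 * s)) + 2 * k * t ^ 2 ≤
      6 * α ^ 2 * (a + b + t) ^ 2
      + 6 * α ^ 2 * k * (a + b + t) * (t + s) := by
  have h₁ : 0 ≤ 6 * α ^ 2 * (a ^ 2 + b ^ 2 + t ^ 2 + 2 * (a * t)
    + 2 * (b * t)) + 9 * α ^ 2 * (a * b) := by positivity
  have h₂ : 0 ≤ (α ^ 2 - 3) * (k * (a * t)) := mul_nonneg (by nlinarith) (by positivity)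
  have h₃ : 0 ≤ 4 * α ^ 2 * (k * (b * t)) := by positivity
  have h₄ : 0 ≤ (6 * α ^ 2 - α) * (k * (a * s)) :=
    mul_nonneg (by nlinarith) (by positivity)
  have h₅ : 0 ≤ (6 * α ^ 2 - α) * (k * (b * s)) :=
    mul_nonneg (by nlinarith) (by positivity)
  have h₆ : 0 ≤ (6 * α ^ 2 - α) * (k * (t * s)) :=
    mul_nonneg (by nlinarith) (by positivity)
  have h₇ : 0 ≤ (6 * α ^ 2 - 2) * (k * t ^ 2) := mul_nonneg (by nlinarith) (by positivity)
  linarith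

set_option maxHeartbeats 800000 in
theorem fastRFBEnergy_succ_sub_le {H : Type*} [NormedAddCommGroup H] [InnerProductSpace ℝ H]
    {α c k ℓ κ : ℝ} {x d g δ e e' δ' : H} (hc : 1 < c) (hcα : c < α - 1) (hk : 1 ≤ k)
    (hℓ : ℓ < 1 / 2) (hκ₁ : 3 * κ ≤ 2 * α - 2 - 2 * c) (hκ₂ : 3 * κ ≤ 2 * (c - 1)) (hκ : 0 < κ)
    (hd : 0 ≤ ⟪δ + e - e', d⟫) (hx : 0 ≤ ⟪x, g + e⟫)
    (he : ‖e‖ ≤ ℓ * ‖δ‖) (he' : ‖e'‖ ≤ ℓ * ‖δ'‖) :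
    fastRFBEnergy α (k + 1) x ((k + 1) • d) g e δ
      - fastRFBEnergy α k (x - d) ((k + α) • d + c • (g - δ) + (k + α) • δ) (g - δ) e' δ' ≤
    -(κ * k * (‖d‖ ^ 2 + ‖g‖ ^ 2)) - (1 / 2 - ℓ) * k ^ 2 * (‖δ‖ ^ 2 + ‖δ'‖ ^ 2)
      + 6 * α ^ 2 * (‖d‖ + ‖g‖ + ‖δ‖) ^ 2
      + 6 * α ^ 2 * k * (‖d‖ + ‖g‖ + ‖δ‖) * (‖δ‖ + ‖δ'‖) + 6 * α ^ 2 * ‖x‖ * ‖δ‖ := by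
  have hα : 2 < α := by linarith
  have hα2 : 2 * α ≤ α ^ 2 := by nlinarith
  have hkα2 : k * (2 * α) ≤ k * α ^ 2 := mul_le_mul_of_nonneg_left hα2 (by linarith)
  have hkα : k * 2 ≤ k * α := mul_le_mul_of_nonneg_left hα.le (by linarith)
  have hαk : 1 * α ≤ k * α := mul_le_mul_of_nonneg_right hk (by linarith)
  have hkc : k * 1 ≤ k * c := mul_le_mul_of_nonneg_left hc.le (by linarith)
  have hkcα : k * c ≤ k * (α - 1) := mul_le_mul_of_nonneg_left hcα.le (by linarith)
  have inner_e (u : H) : |⟪u, e⟫| ≤ ‖u‖ * (1 / 2 * ‖δ‖) :=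
    (abs_real_inner_le_norm u e).trans <| mul_le_mul_of_nonneg_left
      (he.trans (mul_le_mul_of_nonneg_right hℓ.le (norm_nonneg _))) (norm_nonneg _)
  have inner_e' (u : H) : |⟪u, e'⟫| ≤ ‖u‖ * (1 / 2 * ‖δ'‖) :=
    (abs_real_inner_le_norm u e').trans <| mul_le_mul_of_nonneg_left
      (he'.trans (mul_le_mul_of_nonneg_right hℓ.le (norm_nonneg _))) (norm_nonneg _)
  have hδe' : ⟪δ, e'⟫ ≤ ‖δ‖ * (ℓ * ‖δ'‖) :=
    (real_inner_le_norm δ e').trans (mul_le_mul_of_nonneg_left he' (norm_nonneg _))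
  have main : 2 * k ^ 2 * ⟪δ, e'⟫ ≤ ℓ * k ^ 2 * (‖δ‖ ^ 2 + ‖δ'‖ ^ 2) := by
    rcases le_or_gt 0 ℓ with h | h
    · nlinarith [mul_le_mul_of_nonneg_left hδe' (by positivity : 0 ≤ 2 * k ^ 2),
        mul_nonneg (mul_nonneg h (sq_nonneg k)) (sq_nonneg (‖δ‖ - ‖δ'‖))]
    · have h₁ : ‖δ‖ = 0 := by nlinarith [norm_nonneg e, norm_nonneg δ]
      have h₂ : ‖δ'‖ = 0 := by nlinarith [norm_nonneg e', norm_nonneg δ']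
      have h₃ : δ = 0 := norm_eq_zero.1 h₁
      simp [h₂, h₃]
  have quad : κ * k * (‖d‖ ^ 2 + ‖g‖ ^ 2) ≤
      k * ((2 * α - 2 - 2 * c) * ‖d‖ ^ 2 + 2 * (c - 1) * ‖d + g‖ ^ 2) := by
    have hg : ‖g‖ ^ 2 ≤ 2 * ‖d + g‖ ^ 2 + 2 * ‖d‖ ^ 2 := by
      have h : ‖g‖ ≤ ‖d + g‖ + ‖d‖ := by simpa using norm_sub_le (d + g) d
      nlinarith [norm_nonneg g, sq_nonneg (‖d + g‖ - ‖d‖)]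
    have h : κ * (‖d‖ ^ 2 + ‖g‖ ^ 2) ≤
        (2 * α - 2 - 2 * c) * ‖d‖ ^ 2 + 2 * (c - 1) * ‖d + g‖ ^ 2 := by
      nlinarith [mul_le_mul_of_nonneg_left hg hκ.le,
        mul_le_mul_of_nonneg_right hκ₁ (sq_nonneg ‖d‖),
        mul_le_mul_of_nonneg_right hκ₂ (sq_nonneg ‖d + g‖),
        mul_nonneg hκ.le (sq_nonneg ‖d + g‖)]
    nlinarith
  have xe : 2 * α * (c - 1) * ⟪x, e⟫ ≤ 2 * α ^ 2 * (‖x‖ * (1 / 2 * ‖δ‖)) :=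
    mul_le_mul_of_abs_le (by rw [abs_of_nonneg (by nlinarith)]; nlinarith) (inner_e x)
  have xδ : -(α * (2 * α - 2 * c)) * ⟪x, δ⟫ ≤ 2 * α ^ 2 * (‖x‖ * ‖δ‖) :=
    mul_le_mul_of_abs_le (by rw [abs_neg, abs_of_nonneg (by nlinarith)]; nlinarith)
      (abs_real_inner_le_norm _ _)
  have dg : -(4 * c - 4 + α) * ⟪d, g⟫ ≤ 3 * α ^ 2 * (‖d‖ * ‖g‖) :=
    mul_le_mul_of_abs_le (by rw [abs_neg, abs_of_nonneg (by linarith)]; linarith)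
      (abs_real_inner_le_norm _ _)
  have dδ : -(2 * (k * (1 + 2 * α - 2 * c) + 2 * α - 2 * c) + (2 * α - 2) * k) * ⟪d, δ⟫ ≤
      5 * α ^ 2 * k * (‖d‖ * ‖δ‖) :=
    mul_le_mul_of_abs_le (by rw [abs_neg, abs_of_nonneg (by linarith)]; linarith)
      (abs_real_inner_le_norm _ _)
  have gδ : -(k * (2 * α) + 2 * α - 2 * c) * ⟪g, δ⟫ ≤ 2 * α ^ 2 * k * (‖g‖ * ‖δ‖) :=
    mul_le_mul_of_abs_le (by rw [abs_neg, abs_of_nonneg (by linarith)]; linarith)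
      (abs_real_inner_le_norm _ _)
  have de : -(4 * k + 2) * ⟪d, e⟫ ≤ 6 * k * (‖d‖ * (1 / 2 * ‖δ‖)) :=
    mul_le_mul_of_abs_le (by rw [abs_neg, abs_of_nonneg (by linarith)]; linarith) (inner_e d)
  have de' : 2 * k * α * ⟪d, e'⟫ ≤ 2 * k * α * (‖d‖ * (1 / 2 * ‖δ'‖)) :=
    mul_le_mul_of_abs_le (abs_of_nonneg (by positivity)).le (inner_e' d)
  have ge' : 2 * k * c * ⟪g, e'⟫ ≤ 2 * k * α * (‖g‖ * (1 / 2 * ‖δ'‖)) :=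
    mul_le_mul_of_abs_le (by rw [abs_of_nonneg (by positivity)]; linarith) (inner_e' g)
  have δe' : 2 * k * (α - c) * ⟪δ, e'⟫ ≤ 2 * k * α * (‖δ‖ * (1 / 2 * ‖δ'‖)) :=
    mul_le_mul_of_abs_le (by rw [abs_of_nonneg (by linarith)]; linarith) (inner_e' δ)
  have δδ : (k + 1 / 2 - (2 * α - 2 * c) * k) * ‖δ‖ ^ 2 ≤ 2 * k * ‖δ‖ ^ 2 :=
    mul_le_mul_of_nonneg_right (by linarith) (sq_nonneg _)
  have dd : 0 ≤ (2 * α - 4 + α * (α / 2 - 1)) * ‖d‖ ^ 2 :=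
    mul_nonneg (by nlinarith) (sq_nonneg _)
  have gg : 0 ≤ (2 * c - 3 / 2) * ‖g‖ ^ 2 := mul_nonneg (by linarith) (sq_nonneg _)
  have hd' : 0 ≤ 2 * k ^ 2 * ⟪δ + e - e', d⟫ := by positivity
  have hx' : 0 ≤ 2 * α * (c - 1) * ⟪x, g + e⟫ := mul_nonneg (by nlinarith) hx
  have hr := sq_nonneg ‖(α - 2) • d + (2 * c - 1) • g + (2 * α - 2 * c) • δ‖
  have sum_bound := cross_terms_le (a := ‖d‖) (b := ‖g‖) (t := ‖δ‖) (s := ‖δ'‖) hα.le hk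
    (norm_nonneg _) (norm_nonneg _) (norm_nonneg _) (norm_nonneg _)
  have x_bound : 2 * α ^ 2 * (‖x‖ * (1 / 2 * ‖δ‖)) + 2 * α ^ 2 * (‖x‖ * ‖δ‖) ≤
      6 * α ^ 2 * ‖x‖ * ‖δ‖ := by
    have h : 0 ≤ α ^ 2 * (‖x‖ * ‖δ‖) := by positivity
    linarith
  rw [fastRFBEnergy_succ_sub]
  linarith

theorem young_le_of_large {C κ ν k a b t s x : ℝ} (hC : 0 < C) (hν : 0 < ν) (hk : 1 ≤ k)
    (h₁ : 3 * C + 8 * C ^ 2 / ν ≤ κ * k) (h₂ : 16 * C ≤ ν * k) :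
    -(κ * k * (a ^ 2 + b ^ 2)) - ν * k ^ 2 * (t ^ 2 + s ^ 2) + C * (a + b + t) ^ 2
      + C * k * (a + b + t) * (t + s) + C * x * t ≤
    -(ν / 4 * k ^ 2 * t ^ 2) + C ^ 2 / ν * x ^ 2 / k ^ 2 := by
  have hk0 : 0 < k := by linarith
  have young (p q : ℝ) : C * k * (p * q) ≤ ν / 16 * k ^ 2 * q ^ 2 + 4 * C ^ 2 / ν * p ^ 2 := by
    have h : ν / 16 * k ^ 2 * q ^ 2 + 4 * C ^ 2 / ν * p ^ 2 - C * k * (p * q) =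
        (ν * k * q - 8 * C * p) ^ 2 / (16 * ν) := by
      field_simp
      ring
    have := div_nonneg (sq_nonneg (ν * k * q - 8 * C * p)) (by positivity : 0 ≤ 16 * ν)
    linarith
  have hx : C * x * t ≤ ν / 4 * k ^ 2 * t ^ 2 + C ^ 2 / ν * x ^ 2 / k ^ 2 := by
    have h : ν / 4 * k ^ 2 * t ^ 2 + C ^ 2 / ν * x ^ 2 / k ^ 2 - C * x * t =
        (ν * k ^ 2 * t - 2 * C * x) ^ 2 / (4 * ν * k ^ 2) := by
      field_simp
      ring
    have := div_nonneg (sq_nonneg (ν * k ^ 2 * t - 2 * C * x)) (by positivity : 0 ≤ 4 * ν * k ^ 2)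
    linarith
  have hsq : C * (a + b + t) ^ 2 ≤ C * (3 * (a ^ 2 + b ^ 2 + t ^ 2)) :=
    mul_le_mul_of_nonneg_left
      (by nlinarith [sq_nonneg (a - b), sq_nonneg (a - t), sq_nonneg (b - t)]) hC.le
  have hts : C * k * (t * (t + s)) ≤ C * k * (3 / 2 * (t ^ 2 + s ^ 2)) :=
    mul_le_mul_of_nonneg_left (by nlinarith [sq_nonneg (t - s)]) (by positivity)
  have hab := mul_le_mul_of_nonneg_right h₁ (by positivity : 0 ≤ a ^ 2 + b ^ 2)
  have hkts : 16 * C * k * (t ^ 2 + s ^ 2) ≤ ν * k ^ 2 * (t ^ 2 + s ^ 2) :=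
    mul_le_mul_of_nonneg_right (by nlinarith) (by positivity)
  have hCt : C * t ^ 2 ≤ C * k * (t ^ 2 + s ^ 2) :=
    mul_le_mul (by nlinarith) (by nlinarith) (by positivity) (by positivity)
  have hpos : 0 ≤ ν * k ^ 2 * s ^ 2 := by positivity
  have hpos' : 0 ≤ ν * k ^ 2 * t ^ 2 := by positivity
  have e₁ : 8 * C ^ 2 / ν = 2 * (4 * C ^ 2 / ν) := by ring
  rw [e₁] at hab
  linarith [young a t, young a s, young b t, young b s]

/-- A Robbins–Siegmund type lemma with the summable perturbation `B / k ^ 2`. -/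
theorem summable_and_bounded_of_descent {E q : ℕ → ℝ} {B : ℝ} {N : ℕ} (hB : 0 ≤ B)
    (hE : ∀ k ≥ N, 0 ≤ E k) (hq : ∀ k, 0 ≤ q k)
    (h : ∀ k ≥ N, E (k + 1) + q k ≤ E k + B / (k : ℝ) ^ 2 * E (k + 1)) :
    Summable q ∧ ∃ R, ∀ᶠ k in atTop, E k ≤ R := by
  obtain ⟨n, hn⟩ := exists_nat_gt (4 * B)
  set N' := max N (max n 1) with hN'
  set Φ : ℕ → ℝ := fun k => (1 + 4 * B / k) * E k with hΦ
  have step (k : ℕ) (hk : N' ≤ k) : q k + Φ (k + 1) ≤ Φ k := by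
    have hkN : N ≤ k := by omega
    have hk1 : (1 : ℝ) ≤ k := by exact_mod_cast (by omega : 1 ≤ k)
    have hkn : 4 * B ≤ k := hn.le.trans (by exact_mod_cast (by omega : n ≤ k))
    have hk0 : (0 : ℝ) < k := by linarith
    have hb : 0 ≤ 4 * B / (k : ℝ) := by positivity
    have hb1 : 4 * B / (k : ℝ) ≤ 1 := (div_le_one hk0).2 hkn
    have h₁ : (1 + 4 * B / k) * (E (k + 1) + q k) ≤
        (1 + 4 * B / k) * (E k + B / (k : ℝ) ^ 2 * E (k + 1)) :=
      mul_le_mul_of_nonneg_left (h k hkN) (by linarith)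
    have h₂ : 2 * B / (k : ℝ) ^ 2 ≤ 4 * B / k - 4 * B / (k + 1) := by
      rw [div_sub_div _ _ hk0.ne' (by positivity), div_le_div_iff₀ (by positivity) (by positivity)]
      have : 0 ≤ 2 * B * k ^ 2 * (k - 1) := mul_nonneg (by positivity) (by linarith)
      nlinarith
    have h₃ : (1 + 4 * B / k) * (B / (k : ℝ) ^ 2) ≤ 2 * B / (k : ℝ) ^ 2 := by
      rw [mul_div_assoc 2]
      exact mul_le_mul_of_nonneg_right (by linarith) (by positivity)
    have h₄ := mul_le_mul_of_nonneg_right (h₃.trans h₂) (hE (k + 1) (by omega))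
    have h₅ := mul_nonneg hb (hq k)
    simp only [hΦ, Nat.cast_add, Nat.cast_one]
    linarith
  have Φ_nonneg (k : ℕ) (hk : N' ≤ k) : 0 ≤ Φ k :=
    mul_nonneg (by positivity) (hE k (by omega))
  have partial_sum (m : ℕ) : ∑ i ∈ Finset.range m, q (i + N') + Φ (m + N') ≤ Φ N' := by
    induction m with
    | zero => simp
    | succ m ih =>
      rw [Finset.sum_range_succ, Nat.add_right_comm m 1]
      linarith [step (m + N') (by omega)]
  refine ⟨(summable_nat_add_iff N').1 (summable_of_sum_range_le (c := Φ N') (fun i => hq _)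
    fun m => by linarith [partial_sum m, Φ_nonneg (m + N') (by omega)]), Φ N', ?_⟩
  filter_upwards [eventually_ge_atTop N'] with k hk
  have h₁ := partial_sum (k - N')
  rw [Nat.sub_add_cancel hk] at h₁
  have h₂ := Finset.sum_nonneg fun i (_ : i ∈ Finset.range (k - N')) => hq (i + N')
  have h₃ : E k ≤ Φ k := le_mul_of_one_le_left (hE k (by omega))
    (by have : 0 ≤ 4 * B / (k : ℝ) := by positivity
        linarith)
  linarith

theorem summable_norm_mul_norm_of_fastRFB {H : Type*} [NormedAddCommGroup H]
    [InnerProductSpace ℝ H] {α c ℓ : ℝ} {x g e : ℕ → H} (hc : 1 < c) (hcα : c < α - 1)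
    (hℓ : ℓ < 1 / 2)
    (hrec : ∀ k : ℕ, 1 ≤ k → (k : ℝ) • (x k - x (k - 1)) =
      (k + α) • (x (k + 1) - x k) + c • g k + (k + α) • (g (k + 1) - g k))
    (hmono : ∀ k : ℕ, 1 ≤ k → 0 ≤ ⟪(g (k + 1) + e (k + 1)) - (g k + e k), x (k + 1) - x k⟫)
    (hx : ∀ k : ℕ, 1 ≤ k → 0 ≤ ⟪x k, g k + e k⟫)
    (he : ∀ k : ℕ, 2 ≤ k → ‖e k‖ ≤ ℓ * ‖g k - g (k - 1)‖) :
    Summable fun k : ℕ => ‖x k‖ * ‖g k - g (k - 1)‖ := by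
  have hα : 2 < α := by linarith
  set C := 6 * α ^ 2 with hCdef
  have hC : 0 < C := by positivity
  set ν := 1 / 2 - ℓ with hνdef
  have hν : 0 < ν := by linarith
  set κ := min (2 * α - 2 - 2 * c) (2 * (c - 1)) / 3 with hκdef
  have hκ : 0 < κ := div_pos (lt_min (by linarith) (by linarith)) three_pos
  have hκ₁ : 3 * κ ≤ 2 * α - 2 - 2 * c := by
    rw [hκdef, mul_div_cancel₀ _ three_ne_zero]
    exact min_le_left _ _
  have hκ₂ : 3 * κ ≤ 2 * (c - 1) := by
    rw [hκdef, mul_div_cancel₀ _ three_ne_zero]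
    exact min_le_right _ _
  set μ := α * (α / 2 - 1)
  have hμ : 0 < μ := mul_pos (by linarith) (by linarith)
  set E : ℕ → ℝ := fun k => fastRFBEnergy α k (x k) ((k : ℝ) • (x k - x (k - 1))) (g k) (e k)
    (g k - g (k - 1)) with hEdef
  have E_lower (k : ℕ) (hk : 2 ≤ k) : μ * ‖x k‖ ^ 2 ≤ E k :=
    le_fastRFBEnergy (by linarith) k.cast_nonneg (hx k (by omega))
      ((he k hk).trans (mul_le_mul_of_nonneg_right hℓ.le (norm_nonneg _)))
  obtain ⟨n₁, hn₁⟩ := exists_nat_gt ((3 * C + 8 * C ^ 2 / ν) / κ)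
  obtain ⟨n₂, hn₂⟩ := exists_nat_gt (16 * C / ν)
  have descent (k : ℕ) (hk : max 2 (max n₁ n₂) ≤ k) :
      E (k + 1) + ν / 4 * k ^ 2 * ‖g (k + 1) - g k‖ ^ 2 ≤
        E k + (C ^ 2 / ν / μ) / (k : ℝ) ^ 2 * E (k + 1) := by
    have hk1 : (1 : ℝ) ≤ k := by exact_mod_cast (by omega : 1 ≤ k)
    have h₁ : 3 * C + 8 * C ^ 2 / ν ≤ κ * k := by
      rw [mul_comm κ, ← div_le_iff₀ hκ]
      exact hn₁.le.trans (by exact_mod_cast (by omega : n₁ ≤ k))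
    have h₂ : 16 * C ≤ ν * k := by
      rw [mul_comm ν, ← div_le_iff₀ hν]
      exact hn₂.le.trans (by exact_mod_cast (by omega : n₂ ≤ k))
    have step := (fastRFBEnergy_succ_sub_le (x := x (k + 1)) (d := x (k + 1) - x k)
      (g := g (k + 1)) (δ := g (k + 1) - g k) (e := e (k + 1)) (e' := e k)
      (δ' := g k - g (k - 1)) hc hcα hk1 hℓ hκ₁ hκ₂ hκ
      (by convert hmono k (by omega) using 2; abel) (hx (k + 1) (by omega))
      (he (k + 1) (by omega)) (he k (by omega))).trans (young_le_of_large hC hν hk1 h₁ h₂)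
    rw [sub_sub_cancel, sub_sub_cancel, ← hrec k (by omega), ← hνdef,
      ← hCdef] at step
    have hE' : C ^ 2 / ν * ‖x (k + 1)‖ ^ 2 / (k : ℝ) ^ 2 ≤
        (C ^ 2 / ν / μ) / (k : ℝ) ^ 2 * E (k + 1) := by
      have h := mul_le_mul_of_nonneg_left (E_lower (k + 1) (by omega))
        (by positivity : 0 ≤ (C ^ 2 / ν / μ) / (k : ℝ) ^ 2)
      refine le_trans (le_of_eq ?_) h
      field_simp
    simp only [hEdef, Nat.cast_add, Nat.cast_one, Nat.add_sub_cancel] at hE' ⊢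
    linarith
  obtain ⟨hsum, R, hR⟩ := summable_and_bounded_of_descent (by positivity)
    (fun k hk => (by positivity : 0 ≤ μ * ‖x k‖ ^ 2).trans (E_lower k (by omega)))
    (fun k => by positivity) descent
  rw [← summable_nat_add_iff 1]
  simp only [Nat.add_sub_cancel]
  have hinv : Summable fun k : ℕ => R / μ * (1 / (k : ℝ) ^ 2) :=
    (Real.summable_one_div_nat_pow.2 one_lt_two).mul_left _
  refine Summable.of_norm_bounded_eventually_nat (hinv.add (hsum.mul_left (4 / ν))) ?_
  filter_upwards [(tendsto_add_atTop_nat 1).eventually hR, eventually_ge_atTop 1] with k hRk hk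
  have hk0 : (0 : ℝ) < k := by exact_mod_cast hk
  have hxR : ‖x (k + 1)‖ ^ 2 ≤ R / μ := by
    rw [le_div_iff₀ hμ, mul_comm]
    exact (E_lower (k + 1) (by omega)).trans hRk
  have hxR' := mul_le_mul_of_nonneg_right hxR (by positivity : 0 ≤ 1 / (k : ℝ) ^ 2)
  have hprod : ‖x (k + 1)‖ * ‖g (k + 1) - g k‖ =
      (‖x (k + 1)‖ / k) * (k * ‖g (k + 1) - g k‖) := by field_simp
  have hsq : ‖x (k + 1)‖ ^ 2 * (1 / (k : ℝ) ^ 2) = (‖x (k + 1)‖ / k) ^ 2 := by ring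
  have hq : 4 / ν * (ν / 4 * k ^ 2 * ‖g (k + 1) - g k‖ ^ 2) =
      (k * ‖g (k + 1) - g k‖) ^ 2 := by field_simp
  rw [Real.norm_of_nonneg (by positivity), hprod, hq]
  nlinarith [sq_nonneg (‖x (k + 1)‖ / k - k * ‖g (k + 1) - g k‖),
    sq_nonneg (‖x (k + 1)‖ / k), sq_nonneg (k * ‖g (k + 1) - g k‖)]

theorem stmt_18
    {H : Type*} [NormedAddCommGroup H] [InnerProductSpace ℝ H] [CompleteSpace H]
    (M : H → Set H) (F : H → H) (L α c γ : ℝ)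
    (hM : ∀ z y u' v', u' ∈ M z → v' ∈ M y → 0 ≤ ⟪v' - u', y - z⟫)
    (hFmono : ∀ z y, 0 ≤ ⟪F y - F z, y - z⟫)
    (hL : 0 < L)
    (hFlip : ∀ z y, ‖F y - F z‖ ≤ L * ‖y - z‖)
    (hα : 2 < α) (hcl : α / 2 < c) (hcu : c < α - 1)
    (hγ0 : 0 < γ) (hγ : γ < 1 / (2 * L))
    (z w ξ v : ℕ → H)
    (hξ : ∀ k : ℕ, 1 ≤ k → ξ k ∈ M (z k))
    (hv : ∀ k : ℕ, 1 ≤ k → v k = ξ k + F (w (k - 1)))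
    (hw : ∀ k : ℕ, 1 ≤ k →
      w k = z k + ((k : ℝ) / ((k : ℝ) + α)) • (z k - z (k - 1)) - ((c / ((k : ℝ) + α)) * γ) • v k)
    (hz : ∀ k : ℕ, 1 ≤ k → z (k + 1) = w k - γ • (v (k + 1) - v k))
    (zs : H) (hzs : -F zs ∈ M zs) :
    ∃ S : ℝ, Tendsto (fun K : ℕ => ∑ k ∈ Finset.Icc 2 K, |⟪z k - zs, F (w (k - 1)) - F (z k)⟫|)
      atTop (nhds S) := by
  have hℓ : γ * L < 1 / 2 := by
    rw [lt_div_iff₀ (by positivity)] at hγ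
    linarith
  have hw' (k : ℕ) (hk : 2 ≤ k) : w (k - 1) - z k = γ • (v k - v (k - 1)) := by
    have h := hz (k - 1) (by omega)
    rw [Nat.sub_add_cancel (by omega)] at h
    rw [h, sub_sub_cancel]
  have hF (k : ℕ) (hk : 2 ≤ k) :
      ‖F (w (k - 1)) - F (z k)‖ ≤ L * ‖γ • v k - γ • v (k - 1)‖ := by
    rw [← smul_sub, ← hw' k hk]
    exact hFlip _ _
  have heq (k : ℕ) (hk : 1 ≤ k) :
      γ • v k + γ • (F (z k) - F (w (k - 1))) = γ • (ξ k + F (z k)) := by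
    rw [hv k hk, ← smul_add]
    congr 1
    abel
  have key := summable_norm_mul_norm_of_fastRFB (α := α) (c := c) (ℓ := γ * L)
    (x := fun k => z k - zs) (g := fun k => γ • v k)
    (e := fun k => γ • (F (z k) - F (w (k - 1)))) (by linarith) hcu hℓ ?_ ?_ ?_ ?_
  · have habs : Summable fun k => |⟪z k - zs, F (w (k - 1)) - F (z k)⟫| := by
      refine Summable.of_norm_bounded_eventually_nat (key.mul_left L) ?_
      filter_upwards [eventually_ge_atTop 2] with k hk
      rw [Real.norm_eq_abs, abs_abs]
      refine (abs_real_inner_le_norm _ _).trans ?_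
      rw [mul_left_comm]
      exact mul_le_mul_of_nonneg_left (hF k hk) (norm_nonneg _)
    set f : ℕ → ℝ := fun k => |⟪z k - zs, F (w (k - 1)) - F (z k)⟫| with hf
    refine ⟨∑' k, f (k + 2), ?_⟩
    have h := ((summable_nat_add_iff 2).2 habs).hasSum.tendsto_sum_nat
    refine (h.comp (tendsto_sub_atTop_nat 1)).congr fun K => ?_
    rw [Function.comp_apply, ← Finset.Ico_succ_right_eq_Icc, Finset.sum_Ico_eq_sum_range]
    exact Finset.sum_congr (by simp) fun k _ => by rw [add_comm]
  · intro k hk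
    have hkα : (k : ℝ) + α ≠ 0 := by positivity
    have h := hz k hk
    rw [hw k hk] at h
    simp only [h, sub_sub_sub_cancel_right]
    match_scalars <;> field_simp <;> ring
  · intro k hk
    simp only [heq k hk, heq (k + 1) (by omega), sub_sub_sub_cancel_right, ← smul_sub,
      real_inner_smul_left]
    refine mul_nonneg hγ0.le ?_
    rw [add_sub_add_comm, inner_add_left]
    exact add_nonneg (hM _ _ _ _ (hξ k hk) (hξ (k + 1) (by omega))) (hFmono _ _)
  · intro k hk
    simp only [heq k hk, real_inner_smul_right]
    refine mul_nonneg hγ0.le ?_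
    have h := add_nonneg (hM _ _ _ _ hzs (hξ k hk)) (hFmono zs (z k))
    rw [← inner_add_left] at h
    rw [real_inner_comm]
    convert h using 2
    abel
  · intro k hk
    rw [norm_smul, Real.norm_of_nonneg hγ0.le, norm_sub_rev, mul_assoc]
    exact mul_le_mul_of_nonneg_left (hF k hk) hγ0.le
end

section
/- Let (x*, λ*) be a saddle point of Ψ, let (x, λ) ∈ X × Y, and let u ∈ X and v ∈ Y be subgradients of f at x and of g at λ respectively (i.e., f(x') ≥ f(x) + ⟨u, x' − x⟩ for all x' ∈ X and g(λ') ≥ g(λ) + ⟨v, λ' − λ⟩ for all λ' ∈ Y). Then 0 ≤ Ψ(x, λ*) − Ψ(x*, λ) ≤ ⟨u + ∇_xΦ(x, λ), x − x*⟩ + ⟨v − ∇_λΦ(x, λ), λ − λ*⟩. -/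
open scoped RealInnerProductSpace Pointwise
open Filter

/-- A differentiable convex function lies above its tangent hyperplanes. -/
theorem ConvexOn.add_inner_gradient_le {E : Type*} [NormedAddCommGroup E] [InnerProductSpace ℝ E]
    [CompleteSpace E] {h : E → ℝ} {a d : E} (hc : ConvexOn ℝ Set.univ h)
    (hd : HasGradientAt h d a) (b : E) : h a + ⟪d, b - a⟫ ≤ h b := by
  have hcl : ConvexOn ℝ Set.univ (h ∘ AffineMap.lineMap (k := ℝ) a b) := by
    simpa using hc.comp_affineMap (AffineMap.lineMap (k := ℝ) a b)
  have hderiv : HasDerivAt (h ∘ AffineMap.lineMap (k := ℝ) a b) ⟪d, b - a⟫ 0 := by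
    have hda : HasFDerivAt h (InnerProductSpace.toDual ℝ E d)
        (AffineMap.lineMap (k := ℝ) a b 0) := by
      simpa using hd.hasFDerivAt
    simpa using hda.comp_hasDerivAt (0 : ℝ) AffineMap.hasDerivAt_lineMap
  have hs := hcl.le_slope_of_hasDerivAt (Set.mem_univ 0) (Set.mem_univ 1) zero_lt_one hderiv
  simp only [slope_def_field, Function.comp_apply, AffineMap.lineMap_apply_one,
    AffineMap.lineMap_apply_zero, sub_zero, div_one] at hs
  linarith

/-- A differentiable concave function lies below its tangent hyperplanes. -/
theorem ConcaveOn.le_add_inner_gradient {E : Type*} [NormedAddCommGroup E] [InnerProductSpace ℝ E]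
    [CompleteSpace E] {h : E → ℝ} {a d : E} (hc : ConcaveOn ℝ Set.univ h)
    (hd : HasGradientAt h d a) (b : E) : h b ≤ h a + ⟪d, b - a⟫ := by
  have hneg : HasGradientAt (-h) (-d) a := by
    rw [hasGradientAt_iff_hasFDerivAt, map_neg]
    exact hd.hasFDerivAt.neg
  have := hc.neg.add_inner_gradient_le hneg b
  simp only [Pi.neg_apply, inner_neg_left] at this
  linarith

theorem stmt_19
    {X : Type*} [NormedAddCommGroup X] [InnerProductSpace ℝ X] [CompleteSpace X]
    {Y : Type*} [NormedAddCommGroup Y] [InnerProductSpace ℝ Y] [CompleteSpace Y]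
    (f : X → ℝ) (g : Y → ℝ) (Φ : X → Y → ℝ) (Φx : X → Y → X) (Φy : X → Y → Y)
    (hf : ConvexOn ℝ Set.univ f) (hg : ConvexOn ℝ Set.univ g)
    (hΦx : ∀ (a : X) (b : Y), HasGradientAt (fun x' => Φ x' b) (Φx a b) a)
    (hΦy : ∀ (a : X) (b : Y), HasGradientAt (fun y' => Φ a y') (Φy a b) b)
    (hΦcvx : ∀ b : Y, ConvexOn ℝ Set.univ fun x' => Φ x' b)
    (hΦccv : ∀ a : X, ConcaveOn ℝ Set.univ fun y' => Φ a y')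
    (xs : X) (ls : Y)
    (hsad : ∀ (x' : X) (l' : Y),
      f xs + Φ xs l' - g l' ≤ f xs + Φ xs ls - g ls ∧
      f xs + Φ xs ls - g ls ≤ f x' + Φ x' ls - g ls)
    (x0 : X) (l0 : Y) (u : X) (v : Y)
    (hu : ∀ x' : X, f x0 + ⟪u, x' - x0⟫ ≤ f x')
    (hv : ∀ l' : Y, g l0 + ⟪v, l' - l0⟫ ≤ g l') :
    0 ≤ (f x0 + Φ x0 ls - g ls) - (f xs + Φ xs l0 - g l0) ∧
    (f x0 + Φ x0 ls - g ls) - (f xs + Φ xs l0 - g l0) ≤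
      ⟪u + Φx x0 l0, x0 - xs⟫ + ⟪v - Φy x0 l0, l0 - ls⟫ := by
  have hx := (hΦcvx l0).add_inner_gradient_le (hΦx x0 l0) xs
  have hy := (hΦccv x0).le_add_inner_gradient (hΦy x0 l0) ls
  have hux := hu xs
  have hvl := hv ls
  obtain ⟨hl, hr⟩ := hsad x0 l0
  refine ⟨by linarith, ?_⟩
  rw [inner_add_left, inner_sub_left]
  simp only [inner_sub_right] at *
  linarith
end
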